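/- arXiv:math/0611146 — 8 statements merged into one kernel-verified Lean document; each statement's English description precedes it below -/
import Mathlib

section
/- For every real number m, all matrices A, B ∈ SL(2,ℝ) and every z in the upper half-plane ℍ, the quantity σ_m(A,B) = j_A(Bz;m)·j_B(z;m)·j_{AB}(z;m)^{−1} is independent of z and belongs to the set {1, e^{2πim}, e^{−2πim}}. Equivalently, writing (c_A,d_A), (c_B,d_B), (c_{AB},d_{AB}) for the bottom rows of A, B, AB respectively, the real number Arg(c_A·(Bz)+d_A) + Arg(c_B·z+d_B) − Arg(c_{AB}·z+d_{AB}) lies in {−2π, 0, 2π} and takes the same value for all z ∈ ℍ. -/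
open Complex

/-- The automorphy factor `j_A(z;m) = e^{i m Arg(c z + d)}`. -/
noncomputable def jFactor (m : ℝ) (A : Matrix (Fin 2) (Fin 2) ℝ) (z : ℂ) : ℂ :=
  Complex.exp (Complex.I * (m : ℂ) * (((A 1 0 : ℝ) : ℂ) * z + ((A 1 1 : ℝ) : ℂ)).arg)

/-- The Möbius action of a real 2×2 matrix on ℂ. -/
noncomputable def moebius (A : Matrix (Fin 2) (Fin 2) ℝ) (z : ℂ) : ℂ :=
  (((A 0 0 : ℝ) : ℂ) * z + ((A 0 1 : ℝ) : ℂ)) / (((A 1 0 : ℝ) : ℂ) * z + ((A 1 1 : ℝ) : ℂ))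

/-- `σ_m(A,B) = j_A(Bz;m) · j_B(z;m) · j_{AB}(z;m)⁻¹`. -/
noncomputable def sigmaFn (m : ℝ) (A B : Matrix (Fin 2) (Fin 2) ℝ) (z : ℂ) : ℂ :=
  jFactor m A (moebius B z) * jFactor m B z * (jFactor m (A * B) z)⁻¹

/-- `Arg(c_A·(Bz)+d_A) + Arg(c_B·z+d_B) − Arg(c_{AB}·z+d_{AB})`. -/
noncomputable def argSum (A B : Matrix (Fin 2) (Fin 2) ℝ) (z : ℂ) : ℝ :=
  (((A 1 0 : ℝ) : ℂ) * moebius B z + ((A 1 1 : ℝ) : ℂ)).arg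
    + (((B 1 0 : ℝ) : ℂ) * z + ((B 1 1 : ℝ) : ℂ)).arg
    - ((((A * B) 1 0 : ℝ) : ℂ) * z + (((A * B) 1 1 : ℝ) : ℂ)).arg

lemma den_ne_zero_aux (c d : ℝ) (h : c ≠ 0 ∨ d ≠ 0) (z : ℂ) (hz : 0 < z.im) :
    (c : ℂ) * z + (d : ℂ) ≠ 0 := by
  intro h0
  have h1 := congrArg Complex.im h0
  have h2 := congrArg Complex.re h0
  simp at h1 h2
  rcases h1 with h1 | h1
  · subst h1
    simp at h2
    simp [h2] at h
  · exact hz.ne' h1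

lemma arg_cont_aux (c d : ℝ) (g : ℂ → ℂ) (S : Set ℂ) (hg : ContinuousOn g S)
    (hS : ∀ z ∈ S, 0 < (g z).im) :
    ContinuousOn (fun z => ((c : ℂ) * g z + (d : ℂ)).arg) S := by
  by_cases hc : c = 0
  · subst hc
    simp only [Complex.ofReal_zero, zero_mul, zero_add]
    exact continuousOn_const
  · intro z hz
    have h1 : ContinuousWithinAt (fun z => (c : ℂ) * g z + (d : ℂ)) S z :=
      (continuousWithinAt_const.mul (hg z hz)).add continuousWithinAt_const
    refine ContinuousAt.comp_continuousWithinAt (g := Complex.arg) (Complex.continuousAt_arg ?_) h1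
    rw [Complex.mem_slitPlane_iff]
    right
    simp [hc, (hS z hz).ne']

lemma row_ne_aux (A : Matrix.SpecialLinearGroup (Fin 2) ℝ) :
    (A : Matrix (Fin 2) (Fin 2) ℝ) 1 0 ≠ 0 ∨ (A : Matrix (Fin 2) (Fin 2) ℝ) 1 1 ≠ 0 := by
  by_contra! h
  have := A.det_coe
  rw [Matrix.det_fin_two, h.1, h.2] at this
  simp at this

lemma moebius_im_aux (B : Matrix.SpecialLinearGroup (Fin 2) ℝ) (z : ℂ) (hz : 0 < z.im) :
    0 < (moebius (B : Matrix (Fin 2) (Fin 2) ℝ) z).im := by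
  have hd := den_ne_zero_aux _ _ (row_ne_aux B) z hz
  have hdet := B.det_coe
  rw [Matrix.det_fin_two] at hdet
  have hn := Complex.normSq_pos.mpr hd
  unfold moebius
  rw [Complex.div_im, ← sub_div]
  refine div_pos ?_ hn
  simp
  have : z.im * ((B : Matrix (Fin 2) (Fin 2) ℝ) 0 0 * (B : Matrix (Fin 2) (Fin 2) ℝ) 1 1 -
    (B : Matrix (Fin 2) (Fin 2) ℝ) 0 1 * (B : Matrix (Fin 2) (Fin 2) ℝ) 1 0) = z.im := by
    rw [hdet, mul_one]
  nlinarith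

lemma argSum_mem_aux (A B : Matrix.SpecialLinearGroup (Fin 2) ℝ) (z : ℂ) (hz : 0 < z.im) :
    argSum (A : Matrix (Fin 2) (Fin 2) ℝ) (B : Matrix (Fin 2) (Fin 2) ℝ) z ∈
      ({-(2 * Real.pi), 0, 2 * Real.pi} : Set ℝ) := by
  have hB := den_ne_zero_aux _ _ (row_ne_aux B) z hz
  have hA := den_ne_zero_aux _ _ (row_ne_aux A) _ (moebius_im_aux B z hz)
  have key : ((((A : Matrix (Fin 2) (Fin 2) ℝ) * (B : Matrix (Fin 2) (Fin 2) ℝ)) 1 0 : ℝ) : ℂ) * z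
      + ((((A : Matrix (Fin 2) (Fin 2) ℝ) * (B : Matrix (Fin 2) (Fin 2) ℝ)) 1 1 : ℝ) : ℂ)
      = ((((A : Matrix (Fin 2) (Fin 2) ℝ) 1 0 : ℝ) : ℂ) * moebius B z
        + (((A : Matrix (Fin 2) (Fin 2) ℝ) 1 1 : ℝ) : ℂ))
      * ((((B : Matrix (Fin 2) (Fin 2) ℝ) 1 0 : ℝ) : ℂ) * z
        + (((B : Matrix (Fin 2) (Fin 2) ℝ) 1 1 : ℝ) : ℂ)) := by
    have e := div_mul_cancel₀ ((((B : Matrix (Fin 2) (Fin 2) ℝ) 0 0 : ℝ) : ℂ) * z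
        + (((B : Matrix (Fin 2) (Fin 2) ℝ) 0 1 : ℝ) : ℂ)) hB
    change moebius B z * _ = _ at e
    rw [add_mul, mul_assoc, e]
    simp only [Matrix.mul_apply, Fin.sum_univ_two]
    push_cast
    ring
  have hang := Complex.arg_mul_coe_angle hA hB
  rw [← key, ← Real.Angle.coe_add, eq_comm, Real.Angle.angle_eq_iff_two_pi_dvd_sub] at hang
  obtain ⟨k, hk⟩ := hang
  change argSum _ _ z = _ at hk
  have hlt : argSum (A : Matrix (Fin 2) (Fin 2) ℝ) (B : Matrix (Fin 2) (Fin 2) ℝ) z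
      < 3 * Real.pi := by
    unfold argSum
    linarith [Complex.arg_le_pi ((((A : Matrix (Fin 2) (Fin 2) ℝ) 1 0 : ℝ) : ℂ) * moebius B z
        + (((A : Matrix (Fin 2) (Fin 2) ℝ) 1 1 : ℝ) : ℂ)),
      Complex.arg_le_pi ((((B : Matrix (Fin 2) (Fin 2) ℝ) 1 0 : ℝ) : ℂ) * z
        + (((B : Matrix (Fin 2) (Fin 2) ℝ) 1 1 : ℝ) : ℂ)),
      Complex.neg_pi_lt_arg (((((A : Matrix (Fin 2) (Fin 2) ℝ) * (B : Matrix (Fin 2) (Fin 2) ℝ)) 1 0 : ℝ) : ℂ) * z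
      + ((((A : Matrix (Fin 2) (Fin 2) ℝ) * (B : Matrix (Fin 2) (Fin 2) ℝ)) 1 1 : ℝ) : ℂ))]
  have hgt : -(3 * Real.pi) < argSum (A : Matrix (Fin 2) (Fin 2) ℝ)
      (B : Matrix (Fin 2) (Fin 2) ℝ) z := by
    unfold argSum
    linarith [Complex.neg_pi_lt_arg ((((A : Matrix (Fin 2) (Fin 2) ℝ) 1 0 : ℝ) : ℂ) * moebius B z
        + (((A : Matrix (Fin 2) (Fin 2) ℝ) 1 1 : ℝ) : ℂ)),
      Complex.neg_pi_lt_arg ((((B : Matrix (Fin 2) (Fin 2) ℝ) 1 0 : ℝ) : ℂ) * z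
        + (((B : Matrix (Fin 2) (Fin 2) ℝ) 1 1 : ℝ) : ℂ)),
      Complex.arg_le_pi (((((A : Matrix (Fin 2) (Fin 2) ℝ) * (B : Matrix (Fin 2) (Fin 2) ℝ)) 1 0 : ℝ) : ℂ) * z
      + ((((A : Matrix (Fin 2) (Fin 2) ℝ) * (B : Matrix (Fin 2) (Fin 2) ℝ)) 1 1 : ℝ) : ℂ))]
  rw [hk] at hlt hgt ⊢
  have hpi := Real.pi_pos
  have h1 : (k : ℝ) < 2 := by nlinarith
  have h2 : (-2 : ℝ) < k := by nlinarith
  have h1' : k < 2 := by exact_mod_cast h1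
  have h2' : -2 < k := by exact_mod_cast h2
  have h3 : k = -1 ∨ k = 0 ∨ k = 1 := by omega
  rcases h3 with rfl | rfl | rfl <;> simp

lemma argSum_cont_aux (A B : Matrix.SpecialLinearGroup (Fin 2) ℝ) :
    ContinuousOn (argSum (A : Matrix (Fin 2) (Fin 2) ℝ) (B : Matrix (Fin 2) (Fin 2) ℝ))
      {z : ℂ | 0 < z.im} := by
  have hm : ContinuousOn (moebius (B : Matrix (Fin 2) (Fin 2) ℝ)) {z : ℂ | 0 < z.im} := by
    unfold moebius
    refine ContinuousOn.div (by fun_prop) (by fun_prop) ?_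
    intro z hz
    exact den_ne_zero_aux _ _ (row_ne_aux B) z hz
  exact ((arg_cont_aux _ _ _ _ hm (fun z hz => moebius_im_aux B z hz)).add
    (arg_cont_aux _ _ (fun z => z) _ continuousOn_id (fun z hz => hz))).sub
    (arg_cont_aux _ _ (fun z => z) _ continuousOn_id (fun z hz => hz))

lemma sigmaFn_eq_aux (m : ℝ) (A B : Matrix (Fin 2) (Fin 2) ℝ) (z : ℂ) :
    sigmaFn m A B z = Complex.exp (Complex.I * m * (argSum A B z : ℝ)) := by
  unfold sigmaFn jFactor argSum
  rw [← Complex.exp_neg, ← Complex.exp_add, ← Complex.exp_add]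
  congr 1
  push_cast
  ring

/-- For all real `m`, matrices `A, B ∈ SL(2,ℝ)` and `z ∈ ℍ`, the quantity
`σ_m(A,B)` is independent of `z` and lies in `{1, e^{2πim}, e^{−2πim}}`;
equivalently, the sum of arguments `argSum A B z` lies in `{−2π, 0, 2π}` and
takes the same value for all `z ∈ ℍ`. -/
theorem stmt0 (m : ℝ) (A B : Matrix.SpecialLinearGroup (Fin 2) ℝ) :
    (∃ w ∈ ({-(2 * Real.pi), 0, 2 * Real.pi} : Set ℝ),
      ∀ z : ℂ, 0 < z.im →
        argSum (A : Matrix (Fin 2) (Fin 2) ℝ) (B : Matrix (Fin 2) (Fin 2) ℝ) z = w) ∧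
    (∃ s ∈ ({1, Complex.exp (2 * Real.pi * m * Complex.I),
        Complex.exp (-(2 * Real.pi * m) * Complex.I)} : Set ℂ),
      ∀ z : ℂ, 0 < z.im →
        sigmaFn m (A : Matrix (Fin 2) (Fin 2) ℝ) (B : Matrix (Fin 2) (Fin 2) ℝ) z = s) := by
  have hconst : ∀ z : ℂ, 0 < z.im →
      argSum (A : Matrix (Fin 2) (Fin 2) ℝ) (B : Matrix (Fin 2) (Fin 2) ℝ) z =
      argSum (A : Matrix (Fin 2) (Fin 2) ℝ) (B : Matrix (Fin 2) (Fin 2) ℝ) Complex.I := by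
    intro z hz
    have hpre : IsPreconnected {z : ℂ | 0 < z.im} := (convex_halfSpace_im_gt 0).isPreconnected
    have hfin : ({-(2 * Real.pi), 0, 2 * Real.pi} : Set ℝ).Finite := by simp
    exact hpre.constant_of_mapsTo hfin.isDiscrete (argSum_cont_aux A B)
      (fun w hw => argSum_mem_aux A B w hw) hz (by simp)
  have hI := argSum_mem_aux A B Complex.I (by simp)
  refine ⟨⟨_, hI, hconst⟩, Complex.exp (Complex.I * m * (argSum (A : Matrix (Fin 2) (Fin 2) ℝ)
      (B : Matrix (Fin 2) (Fin 2) ℝ) Complex.I : ℝ)), ?_, fun z hz => ?_⟩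
  · rcases hI with h | h | h
    · rw [h]
      right; right
      refine congrArg Complex.exp ?_
      push_cast
      ring
    · rw [h]
      left
      simp
    · rw [h]
      right; left
      refine congrArg Complex.exp ?_
      push_cast
      ring
  · rw [sigmaFn_eq_aux, hconst z hz]
end

section
/- For every matrix (a b; c d) ∈ SL(2,ℤ) with c > 0, the rational number (a+d)/c − 12·s(d,c) is an integer. (Equivalently, the value v_η(A) = exp(πi((a+d)/(12c) − s(d,c) − 1/4)) of the eta multiplier system is a 24th root of unity.) -/
open Complex

/-- The sawtooth function `((x))`: `x − ⌊x⌋ − 1/2` for `x ∉ ℤ` and `0` for `x ∈ ℤ`. -/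
noncomputable def sawtooth (x : ℝ) : ℝ :=
  if x = (⌊x⌋ : ℝ) then 0 else x - ⌊x⌋ - 1 / 2

/-- The Dedekind sum `s(d,c) = Σ_{n=1}^{c−1} (n/c)·((dn/c))` for `c > 0`. -/
noncomputable def dedekindSum (d c : ℤ) : ℝ :=
  ∑ n ∈ Finset.Ico 1 c.toNat, ((n : ℝ) / (c : ℝ)) * sawtooth ((d : ℝ) * (n : ℝ) / (c : ℝ))

theorem perm_sq (m : ℕ) (hm : 0 < m) (a b d : ℤ) (hdet : a * d - b * m = 1) :
    ∑ n ∈ Finset.range m, ((d * n) % (m : ℤ)) ^ 2 = ∑ n ∈ Finset.range m, (n : ℤ) ^ 2 := by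
  have hm' : (m : ℤ) ≠ 0 := by positivity
  have hnn : ∀ n : ℕ, 0 ≤ (d * n) % (m : ℤ) := fun n => Int.emod_nonneg _ hm'
  have hlt : ∀ n : ℕ, (d * n) % (m : ℤ) < m := fun n => Int.emod_lt_of_pos _ (by positivity)
  have hmaps : Set.MapsTo (fun n : ℕ => ((d * n) % (m : ℤ)).toNat)
      (Finset.range m : Set ℕ) (Finset.range m : Set ℕ) := by
    intro n _
    have h1 := hnn n
    have h2 := hlt n
    simp only [Finset.coe_range, Set.mem_Iio]
    omega
  have hinj : Set.InjOn (fun n : ℕ => ((d * n) % (m : ℤ)).toNat) (Finset.range m : Set ℕ) := by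
    intro x hx y hy hxy
    simp only [Finset.coe_range, Set.mem_Iio] at hx hy hxy
    have h1 := hnn x
    have h2 := hnn y
    have h3 : (d * x) % (m : ℤ) = (d * y) % (m : ℤ) := by omega
    have h4 : (m : ℤ) ∣ d * x - d * y := Int.ModEq.dvd (Eq.symm h3)
    have h5 : (m : ℤ) ∣ (x : ℤ) - y := by
      have h6 : (x : ℤ) - y = a * (d * x - d * y) - m * (b * (x - y)) := by
        linear_combination (-(x : ℤ) + y) * hdet
      rw [h6]
      exact dvd_sub (h4.mul_left _) (dvd_mul_right _ _)
    have h7 : (x : ℤ) - y = 0 := by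
      apply Int.eq_zero_of_abs_lt_dvd h5
      rw [abs_lt]
      constructor <;> omega
    omega
  refine Finset.sum_nbij (fun n : ℕ => ((d * n) % (m : ℤ)).toNat) (fun n hn => ?_) hinj ?_ ?_
  · exact_mod_cast hmaps hn
  · exact Finset.surjOn_of_injOn_of_card_le _ hmaps hinj le_rfl
  · intro n _
    rw [Int.toNat_of_nonneg (hnn n)]

theorem sum_sq (m : ℕ) : 6 * ∑ n ∈ Finset.range m, (n : ℤ) ^ 2 = m * (m - 1) * (2 * m - 1) := by
  induction m with
  | zero => simp
  | succ k ih =>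
    rw [Finset.sum_range_succ, mul_add, ih]
    push_cast
    ring

theorem sum_id (m : ℕ) : 2 * ∑ n ∈ Finset.range m, (n : ℝ) = m * (m - 1) := by
  induction m with
  | zero => simp
  | succ k ih =>
    rw [Finset.sum_range_succ, mul_add, ih]
    push_cast
    ring

theorem key (m : ℕ) (hm : 0 < m) (a b d : ℤ) (hdet : a * d - b * m = 1) :
    (m : ℤ) ^ 2 ∣ m * (a + d) - 12 * ∑ n ∈ Finset.range m, (n : ℤ) * ((d * n) % (m : ℤ)) := by
  have hp := perm_sq m hm a b d hdet
  have hs := sum_sq m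
  have h1 : (m : ℤ) ^ 2 ∣ ∑ n ∈ Finset.range m, ((d * n) % (m : ℤ) - d * n) ^ 2 := by
    apply Finset.dvd_sum
    intro n _
    apply pow_dvd_pow_of_dvd
    refine ⟨-((d * n) / (m : ℤ)), ?_⟩
    have := Int.mul_ediv_add_emod (d * n) m
    linear_combination this
  have h2 : ∑ n ∈ Finset.range m, ((d * n) % (m : ℤ) - d * n) ^ 2
      = ∑ n ∈ Finset.range m, ((d * n) % (m : ℤ)) ^ 2
        - 2 * d * ∑ n ∈ Finset.range m, (n : ℤ) * ((d * n) % (m : ℤ))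
        + d ^ 2 * ∑ n ∈ Finset.range m, (n : ℤ) ^ 2 := by
    rw [Finset.mul_sum, Finset.mul_sum, ← Finset.sum_sub_distrib, ← Finset.sum_add_distrib]
    apply Finset.sum_congr rfl
    intro n _
    ring
  rw [h2, hp] at h1
  have hcop : IsCoprime ((m : ℤ) ^ 2) d :=
    IsCoprime.pow_left ⟨-b, a, by linear_combination hdet⟩
  apply hcop.dvd_of_dvd_mul_left
  obtain ⟨k, hk⟩ := h1
  refine ⟨6 * k + b - (1 + d ^ 2) * (2 * m - 3), ?_⟩
  linear_combination 6 * hk - (1 + d ^ 2) * hs + m * hdet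

theorem sawtooth_eq (m : ℕ) (hm : 0 < m) (a b d : ℤ) (hdet : a * d - b * m = 1) (n : ℕ)
    (h1 : 1 ≤ n) (h2 : n < m) :
    sawtooth ((d : ℝ) * (n : ℝ) / ((m : ℤ) : ℝ)) = (((d * n) % (m : ℤ) : ℤ) : ℝ) / m - 1 / 2 := by
  have hm' : (m : ℝ) ≠ 0 := by positivity
  have hfl : ⌊(d : ℝ) * (n : ℝ) / ((m : ℤ) : ℝ)⌋ = (d * n) / (m : ℤ) := by
    have := Int.floor_div_natCast (((d * n : ℤ)) : ℝ) m
    rw [Int.floor_intCast] at this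
    push_cast at this ⊢
    exact this
  have hr : (((d * n) % (m : ℤ) : ℤ) : ℝ) = d * n - m * (((d * n) / (m : ℤ) : ℤ) : ℝ) := by
    have h := Int.mul_ediv_add_emod (d * n) m
    have h' : (d * n) % (m : ℤ) = d * n - m * ((d * n) / (m : ℤ)) := by linear_combination h
    rw [h']
    push_cast
    ring
  unfold sawtooth
  rw [hfl, if_neg, hr]
  · push_cast
    field_simp
  · intro h
    push_cast at h
    rw [div_eq_iff hm'] at h
    have h3 : d * n = (d * n) / (m : ℤ) * m := by exact_mod_cast h
    have h5 : (m : ℤ) ∣ (n : ℤ) := by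
      refine ⟨a * ((d * n) / (m : ℤ)) - b * n, ?_⟩
      linear_combination a * h3 - n * hdet
    have := Int.le_of_dvd (by omega) h5
    omega

theorem dedekind_eq (m : ℕ) (hm : 0 < m) (a b d : ℤ) (hdet : a * d - b * m = 1) :
    dedekindSum d m = ((∑ n ∈ Finset.range m, (n : ℤ) * ((d * n) % (m : ℤ)) : ℤ) : ℝ) / m ^ 2
      - (m - 1) / 4 := by
  have hm' : (m : ℝ) ≠ 0 := by positivity
  have h1 : dedekindSum d m = ∑ n ∈ Finset.range m,
      ((n : ℝ) * (((d * n) % (m : ℤ) : ℤ) : ℝ) / m ^ 2 - n / (2 * m)) := by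
    rw [Finset.range_eq_Ico, Finset.sum_eq_sum_Ico_succ_bot hm]
    unfold dedekindSum
    simp only [Int.toNat_natCast, Nat.cast_zero, zero_mul, zero_div, sub_zero, zero_add]
    apply Finset.sum_congr rfl
    intro n hn
    rw [Finset.mem_Ico] at hn
    rw [sawtooth_eq m hm a b d hdet n hn.1 hn.2]
    push_cast
    field_simp
  have h2 := sum_id m
  rw [h1, Finset.sum_sub_distrib, ← Finset.sum_div, ← Finset.sum_div]
  have h3 : ∑ n ∈ Finset.range m, (n : ℝ) = m * (m - 1) / 2 := by linear_combination h2 / 2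
  rw [h3]
  push_cast
  field_simp
  ring

/-- For every `(a b; c d) ∈ SL(2,ℤ)` with `c > 0`, the rational number
`(a+d)/c − 12·s(d,c)` is an integer; equivalently, the eta multiplier value
`v_η(A) = exp(πi((a+d)/(12c) − s(d,c) − 1/4))` is a 24th root of unity. -/
theorem stmt5 (a b c d : ℤ) (hdet : a * d - b * c = 1) (hc : 0 < c) :
    (∃ n : ℤ, ((a : ℝ) + (d : ℝ)) / (c : ℝ) - 12 * dedekindSum d c = (n : ℝ)) ∧
    (Complex.exp (Real.pi * Complex.I *
        (((a : ℂ) + (d : ℂ)) / (12 * (c : ℂ)) - (dedekindSum d c : ℝ) - 1 / 4))) ^ 24 = 1 := by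
  have hint : ∃ n : ℤ, ((a : ℝ) + (d : ℝ)) / (c : ℝ) - 12 * dedekindSum d c = (n : ℝ) := by
    lift c to ℕ using hc.le
    have hm : 0 < c := by exact_mod_cast hc
    have hm' : (c : ℝ) ≠ 0 := by positivity
    obtain ⟨k, hk⟩ := key c hm a b d hdet
    refine ⟨k + 3 * (c - 1), ?_⟩
    rw [dedekind_eq c hm a b d hdet]
    have hk' : (c : ℝ) * (a + d)
        - 12 * ((∑ n ∈ Finset.range c, (n : ℤ) * ((d * n) % (c : ℤ)) : ℤ) : ℝ) = c ^ 2 * k := by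
      exact_mod_cast hk
    generalize ((∑ n ∈ Finset.range c, (n : ℤ) * ((d * n) % (c : ℤ)) : ℤ) : ℝ) = S at *
    push_cast
    field_simp
    linear_combination 4 * hk'
  refine ⟨hint, ?_⟩
  obtain ⟨n, hn⟩ := hint
  have hc' : (c : ℂ) ≠ 0 := by exact_mod_cast hc.ne'
  have hn' : ((a : ℂ) + d) / c - 12 * ((dedekindSum d c : ℝ) : ℂ) = n := by
    exact_mod_cast congrArg (fun x : ℝ => (x : ℂ)) hn
  rw [← Complex.exp_nat_mul, Complex.exp_eq_one_iff]
  refine ⟨n - 3, ?_⟩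
  push_cast
  rw [← hn']
  field_simp
  ring
end

section
/- For every z in the upper half-plane ℍ, the Dedekind eta function satisfies η(−1/z) = (−iz)^{1/2}·η(z), where (−iz)^{1/2} denotes the principal branch of the square root. -/
open Complex Real

/-- The Dedekind eta function `η(z) = e(z/24)·Π_{n=1}^{∞} (1 − e(nz))`,
where `e(x) = e^{2πix}`. -/
noncomputable def dedekindEta (z : ℂ) : ℂ :=
  Complex.exp (2 * Real.pi * Complex.I * z / 24) *
    ∏' n : ℕ, (1 - Complex.exp (2 * Real.pi * Complex.I * ((n : ℂ) + 1) * z))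

lemma dedekindEta_eq_eta (z : ℂ) : dedekindEta z = ModularForm.eta z := by
  unfold dedekindEta ModularForm.eta
  simp only [ModularForm.eta_q_eq_cexp]
  simp [Function.Periodic.qParam]

lemma sqrt_I_mul_aux (z : ℂ) (hz : 0 < z.im) :
    z ^ (1 / 2 : ℂ) = I ^ (1 / 2 : ℂ) * (-(I * z)) ^ (1 / 2 : ℂ) := by
  have hz0 : z ≠ 0 := by rintro rfl; simp at hz
  have hw : -(I * z) ≠ 0 := by simp [hz0]
  have hre : 0 < (-(I * z)).re := by simpa using hz
  have harg : |(-(I * z)).arg| < π / 2 := Complex.abs_arg_lt_pi_div_two_iff.2 (Or.inl hre)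
  have hlog : Complex.log (I * (-(I * z))) = Complex.log I + Complex.log (-(I * z)) := by
    apply Complex.log_mul I_ne_zero hw
    rw [Complex.arg_I]
    have := abs_lt.1 harg
    constructor <;> linarith [Real.pi_pos]
  have hzz : I * (-(I * z)) = z := by
    linear_combination (-z) * I_sq
  rw [hzz] at hlog
  rw [cpow_def_of_ne_zero hz0, cpow_def_of_ne_zero I_ne_zero, cpow_def_of_ne_zero hw, hlog,
    add_mul, Complex.exp_add]

/-- For every `z ∈ ℍ`, `η(−1/z) = (−iz)^{1/2}·η(z)` with the principal branch
of the square root. -/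
theorem stmt7 (z : ℂ) (hz : 0 < z.im) :
    dedekindEta (-1 / z) = (-(Complex.I * z)) ^ (1 / 2 : ℂ) * dedekindEta z := by
  have h := ModularForm.eta_comp_eq_csqrt_I_inv (show z ∈ UpperHalfPlane.upperHalfPlaneSet from hz)
  simp only [Function.comp_apply, Pi.smul_apply, Pi.mul_apply, smul_eq_mul, Complex.sqrt] at h
  have hI : (I : ℂ) ^ (1 / 2 : ℂ) ≠ 0 := by simp [cpow_eq_zero_iff]
  have h2 := sqrt_I_mul_aux z hz
  rw [dedekindEta_eq_eta, dedekindEta_eq_eta, h]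
  simp only [one_div] at h2 hI ⊢
  rw [h2]
  field_simp
end

section
/- For every matrix A = (a b; c d) ∈ SL(2,ℤ) with c > 0 and every z in the upper half-plane ℍ, the Dedekind eta function satisfies η((az+b)/(cz+d)) = exp(πi((a+d)/(12c) − s(d,c)))·(−i(cz+d))^{1/2}·η(z), where (−i(cz+d))^{1/2} denotes the principal branch of the square root. -/
open Complex Real

namespace EtaAux

lemma sawtooth_add_int (x : ℝ) (m : ℤ) : sawtooth (x + m) = sawtooth x := by
  unfold sawtooth
  rw [Int.floor_add_intCast]
  push_cast
  simp only [add_left_inj, add_sub_add_right_eq_sub]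

lemma sawtooth_neg (x : ℝ) : sawtooth (-x) = - sawtooth x := by
  unfold sawtooth
  by_cases h : x = (⌊x⌋ : ℝ)
  · have h2 : -x = ((⌊-x⌋ : ℤ) : ℝ) := by
      rw [h]
      rw [← Int.cast_neg, Int.floor_intCast]
    rw [if_pos h, if_pos h2, neg_zero]
  · have hlt : (⌊x⌋ : ℝ) < x := lt_of_le_of_ne (Int.floor_le x) (Ne.symm h)
    have hfl : ⌊-x⌋ = -⌊x⌋ - 1 := by
      rw [Int.floor_eq_iff]
      push_cast
      constructor
      · linarith [Int.lt_floor_add_one x]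
      · linarith
    have h2 : ¬ (-x = ((⌊-x⌋ : ℤ) : ℝ)) := by
      rw [hfl]
      push_cast
      intro h3
      have := Int.lt_floor_add_one x
      linarith
    rw [if_neg h, if_neg h2, hfl]
    push_cast
    ring

lemma dedekindSum_add_mul (d c k : ℤ) (hc : 0 < c) :
    dedekindSum (d + c * k) c = dedekindSum d c := by
  unfold dedekindSum
  refine Finset.sum_congr rfl fun n _ => ?_
  have hc' : (c : ℝ) ≠ 0 := by exact_mod_cast hc.ne'
  have : ((d + c * k : ℤ) : ℝ) * (n : ℝ) / (c : ℝ) = (d : ℝ) * n / c + ((k * n : ℤ) : ℝ) := by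
    push_cast
    field_simp
  rw [this, sawtooth_add_int]

lemma dedekindSum_neg (d c : ℤ) : dedekindSum (-d) c = - dedekindSum d c := by
  unfold dedekindSum
  rw [← Finset.sum_neg_distrib]
  refine Finset.sum_congr rfl fun n _ => ?_
  have : ((-d : ℤ) : ℝ) * (n : ℝ) / (c : ℝ) = -((d : ℝ) * n / c) := by
    push_cast
    ring
  rw [this, sawtooth_neg]
  ring

lemma not_dvd_of {h k n : ℕ} (hco : Nat.Coprime h k) (hn : n ∈ Finset.Ico 1 k) : ¬ k ∣ h * n := by
  intro hd
  rw [Finset.mem_Ico] at hn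
  have := Nat.le_of_dvd (by omega) (hco.symm.dvd_of_dvd_mul_left hd)
  omega

lemma sawtooth_coprime {h k n : ℕ} (hco : Nat.Coprime h k) (hn : n ∈ Finset.Ico 1 k) :
    sawtooth ((h : ℝ) * n / k) = (h : ℝ) * n / k - ((h * n / k : ℕ) : ℝ) - 1 / 2 := by
  have hk : (k : ℝ) ≠ 0 := by
    rw [Finset.mem_Ico] at hn
    have : k ≠ 0 := by omega
    exact_mod_cast this
  have hfl : ⌊(h : ℝ) * n / k⌋ = ((h * n / k : ℕ) : ℤ) := by
    have h1 : ⌊(h : ℝ) * n / k⌋₊ = h * n / k := by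
      have := Nat.floor_div_eq_div (K := ℝ) (h * n) k
      rwa [Nat.cast_mul] at this
    rw [← h1, Int.natCast_floor_eq_floor (by positivity)]
  unfold sawtooth
  rw [hfl, if_neg]
  · push_cast
    rfl
  · intro he
    apply not_dvd_of hco hn
    rw [div_eq_iff hk] at he
    refine ⟨h * n / k, ?_⟩
    have : ((h * n : ℕ) : ℝ) = ((k * (h * n / k) : ℕ) : ℝ) := by
      rw [Int.cast_natCast] at he
      rw [Nat.cast_mul, Nat.cast_mul, he]
      ring
    exact_mod_cast this

lemma dedekindSum_coprime {h k : ℕ} (hco : Nat.Coprime h k) :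
    dedekindSum h k = ∑ n ∈ Finset.Ico 1 k,
      ((n : ℝ) / k) * ((h : ℝ) * n / k - ((h * n / k : ℕ) : ℝ) - 1 / 2) := by
  unfold dedekindSum
  rw [Int.toNat_natCast]
  refine Finset.sum_congr rfl fun n hn => ?_
  rw [← sawtooth_coprime hco hn]
  push_cast
  rfl

lemma sum_perm {h k : ℕ} (hco : Nat.Coprime h k) (f : ℕ → ℝ) :
    ∑ n ∈ Finset.Ico 1 k, f (h * n % k) = ∑ n ∈ Finset.Ico 1 k, f n := by
  have hmaps : ∀ n ∈ Finset.Ico 1 k, h * n % k ∈ Finset.Ico 1 k := by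
    intro n hn
    have h1 := not_dvd_of hco hn
    rw [Nat.dvd_iff_mod_eq_zero] at h1
    rw [Finset.mem_Ico] at hn ⊢
    have := Nat.mod_lt (h * n) (show k > 0 by omega)
    omega
  have hinj : Set.InjOn (fun n => h * n % k) (Finset.Ico 1 k : Finset ℕ) := by
    intro m hm n hn he
    simp only [Finset.coe_Ico, Set.mem_Ico] at hm hn
    have h2 : h * m ≡ h * n [MOD k] := he
    have h3 : m ≡ n [MOD k] := Nat.ModEq.cancel_left_of_coprime hco.symm h2
    exact Nat.ModEq.eq_of_lt_of_lt h3 hm.2 hn.2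
  have himg : (Finset.Ico 1 k).image (fun n => h * n % k) = Finset.Ico 1 k := by
    apply Finset.eq_of_subset_of_card_le
    · intro x hx
      rw [Finset.mem_image] at hx
      obtain ⟨n, hn, rfl⟩ := hx
      exact hmaps n hn
    · rw [Finset.card_image_of_injOn hinj]
  conv_rhs => rw [← himg]
  rw [Finset.sum_image hinj]

lemma sum_lin (k : ℕ) (hk : 1 ≤ k) : ∑ n ∈ Finset.Ico 1 k, (n : ℝ) = (k : ℝ) * (k - 1) / 2 := by
  induction k, hk using Nat.le_induction with
  | base => simp
  | succ m hm ih =>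
    rw [Finset.sum_Ico_succ_top hm, ih]
    push_cast
    ring

lemma sum_sq (k : ℕ) (hk : 1 ≤ k) :
    ∑ n ∈ Finset.Ico 1 k, (n : ℝ) ^ 2 = (k : ℝ) * (k - 1) * (2 * k - 1) / 6 := by
  induction k, hk using Nat.le_induction with
  | base => simp
  | succ m hm ih =>
    rw [Finset.sum_Ico_succ_top hm, ih]
    push_cast
    ring

lemma sum_one (k : ℕ) (hk : 1 ≤ k) : ∑ _n ∈ Finset.Ico 1 k, (1 : ℝ) = (k : ℝ) - 1 := by
  simp [hk]

/-- lattice point count -/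
lemma sum_floor {h k : ℕ} (hco : Nat.Coprime h k) (hk : 1 ≤ k) (hh : 1 ≤ h) :
    ∑ r ∈ Finset.Ico 1 k, ((h * r / k : ℕ) : ℝ) * (((h * r / k : ℕ) : ℝ) + 1) =
      ∑ v ∈ Finset.Ico 1 h, 2 * (v : ℝ) * ((k : ℝ) - 1 - ((k * v / h : ℕ) : ℝ)) := by
  have h1 : ∀ r ∈ Finset.Ico 1 k, ((h * r / k : ℕ) : ℝ) * (((h * r / k : ℕ) : ℝ) + 1) =
      ∑ v ∈ Finset.Ico 1 h, if k * v < h * r then 2 * (v : ℝ) else 0 := by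
    intro r hr
    have hnd := not_dvd_of hco hr
    rw [Finset.mem_Ico] at hr
    rw [← Finset.sum_filter]
    have : (Finset.Ico 1 h).filter (fun v => k * v < h * r) = Finset.Ico 1 (h * r / k + 1) := by
      ext v
      simp only [Finset.mem_filter, Finset.mem_Ico]
      rw [Nat.lt_succ_iff, Nat.le_div_iff_mul_le (show 0 < k by omega)]
      constructor
      · rintro ⟨⟨h1, h2⟩, h3⟩
        exact ⟨h1, by nlinarith⟩
      · rintro ⟨h1, h2⟩
        have hne : v * k ≠ h * r := fun he => hnd ⟨v, by rw [← he]; ring⟩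
        have hlt : v * k < h * r := lt_of_le_of_ne h2 hne
        refine ⟨⟨h1, ?_⟩, by nlinarith⟩
        by_contra hcon
        push Not at hcon
        nlinarith
    rw [this, ← Finset.mul_sum, sum_lin _ (Nat.le_add_left 1 _)]
    push_cast
    ring
  rw [Finset.sum_congr rfl h1, Finset.sum_comm]
  refine Finset.sum_congr rfl fun v hv => ?_
  rw [← Finset.sum_filter]
  have hnd := not_dvd_of hco.symm hv
  rw [Finset.mem_Ico] at hv
  have hlt : k * v / h < k := by
    rw [Nat.div_lt_iff_lt_mul (by omega)]
    nlinarith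
  have : (Finset.Ico 1 k).filter (fun r => k * v < h * r) = Finset.Ico (k * v / h + 1) k := by
    ext r
    simp only [Finset.mem_filter, Finset.mem_Ico]
    rw [show k * v / h + 1 ≤ r ↔ k * v / h < r from Nat.succ_le_iff,
      Nat.div_lt_iff_lt_mul (show 0 < h by omega)]
    constructor
    · rintro ⟨⟨h1, h2⟩, h3⟩
      exact ⟨by nlinarith, h2⟩
    · rintro ⟨h1, h2⟩
      refine ⟨⟨?_, h2⟩, by nlinarith⟩
      by_contra hcon
      have : r = 0 := by omega
      subst this
      omega
  rw [this, Finset.sum_const, Nat.card_Ico, nsmul_eq_mul, Nat.cast_sub (by omega)]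
  push_cast
  ring

lemma reciprocity {h k : ℕ} (hco : Nat.Coprime h k) (hk : 1 ≤ k) (hh : 1 ≤ h) :
    dedekindSum h k + dedekindSum k h =
      -1 / 4 + ((h : ℝ) / k + (k : ℝ) / h + 1 / ((h : ℝ) * k)) / 12 := by
  have hk0 : (k : ℝ) ≠ 0 := by positivity
  have hh0 : (h : ℝ) ≠ 0 := by positivity
  have hA := dedekindSum_coprime hco
  have hB := dedekindSum_coprime hco.symm
  have hF := sum_floor hco hk hh
  have hP := sum_perm hco (fun n => ((n : ℝ) / k - 1 / 2) ^ 2)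
  have hP1 : ∀ n : ℕ, ((h * n % k : ℕ) : ℝ) / k = (h : ℝ) * n / k - ((h * n / k : ℕ) : ℝ) := by
    intro n
    have := Nat.mod_add_div (h * n) k
    have h2 : ((h * n % k : ℕ) : ℝ) + k * ((h * n / k : ℕ) : ℝ) = (h : ℝ) * n := by
      exact_mod_cast this
    rw [← h2]
    field_simp
    ring
  simp only [hP1] at hP
  have e1 : ∑ n ∈ Finset.Ico 1 k, ((h : ℝ) * n / k - ((h * n / k : ℕ) : ℝ) - 1 / 2) ^ 2 =
      2 * h * dedekindSum h k - (h : ℝ) ^ 2 / (k : ℝ) ^ 2 * ∑ n ∈ Finset.Ico 1 k, (n : ℝ) ^ 2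
      + ∑ r ∈ Finset.Ico 1 k, ((h * r / k : ℕ) : ℝ) * (((h * r / k : ℕ) : ℝ) + 1)
      + 1 / 4 * ∑ _n ∈ Finset.Ico 1 k, (1 : ℝ) := by
    rw [hA, Finset.mul_sum, Finset.mul_sum, Finset.mul_sum, ← Finset.sum_sub_distrib,
      ← Finset.sum_add_distrib, ← Finset.sum_add_distrib]
    refine Finset.sum_congr rfl fun n _ => ?_
    field_simp
    ring
  have e2 : ∑ n ∈ Finset.Ico 1 k, ((n : ℝ) / k - 1 / 2) ^ 2 =
      1 / (k : ℝ) ^ 2 * ∑ n ∈ Finset.Ico 1 k, (n : ℝ) ^ 2 - 1 / k * ∑ n ∈ Finset.Ico 1 k, (n : ℝ)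
      + 1 / 4 * ∑ _n ∈ Finset.Ico 1 k, (1 : ℝ) := by
    rw [Finset.mul_sum, Finset.mul_sum, Finset.mul_sum, ← Finset.sum_sub_distrib,
      ← Finset.sum_add_distrib]
    refine Finset.sum_congr rfl fun n _ => ?_
    field_simp
    ring
  have e3 : ∑ v ∈ Finset.Ico 1 h, 2 * (v : ℝ) * ((k : ℝ) - 1 - ((k * v / h : ℕ) : ℝ)) =
      2 * h * dedekindSum k h + (2 * k - 1) * ∑ n ∈ Finset.Ico 1 h, (n : ℝ)
      - 2 * k / h * ∑ n ∈ Finset.Ico 1 h, (n : ℝ) ^ 2 := by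
    rw [hB, Finset.mul_sum, Finset.mul_sum, Finset.mul_sum, ← Finset.sum_add_distrib,
      ← Finset.sum_sub_distrib]
    refine Finset.sum_congr rfl fun n _ => ?_
    field_simp
    ring
  rw [e1, e2, hF, e3, sum_sq k hk, sum_sq h hh, sum_lin k hk, sum_lin h hh, sum_one k hk] at hP
  have : 2 * (h : ℝ) * (dedekindSum h k + dedekindSum k h) = 2 * (h : ℝ) *
      (-1 / 4 + ((h : ℝ) / k + (k : ℝ) / h + 1 / ((h : ℝ) * k)) / 12) := by
    rw [← sub_eq_zero] at hP ⊢
    rw [← hP]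
    field_simp
    ring
  exact mul_left_cancel₀ (by positivity) this

lemma eta_eq (z : ℂ) : dedekindEta z = ModularForm.eta z := by
  unfold dedekindEta ModularForm.eta
  simp only [ModularForm.eta_q_eq_cexp]
  simp [Function.Periodic.qParam]

lemma eta_add_int (z : ℂ) (k : ℤ) :
    dedekindEta (z + k) = Complex.exp (Real.pi * Complex.I * (k / 12)) * dedekindEta z := by
  unfold dedekindEta
  rw [← mul_assoc, ← Complex.exp_add]
  congr 1
  · congr 1
    ring
  · refine tprod_congr fun n => ?_
    congr 1
    rw [Complex.exp_eq_exp_iff_exists_int]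
    exact ⟨(n + 1) * k, by push_cast; ring⟩

lemma half_mul {x y : ℂ} (hx : 0 < x.re) (hy : 0 < y.re) :
    (x * y) ^ (1 / 2 : ℂ) = x ^ (1 / 2 : ℂ) * y ^ (1 / 2 : ℂ) := by
  have hx0 : x ≠ 0 := by
    rintro rfl
    simp at hx
  have hy0 : y ≠ 0 := by
    rintro rfl
    simp at hy
  have h1 := abs_lt.1 (Complex.abs_arg_lt_pi_div_two_iff.2 (Or.inl hx))
  have h2 := abs_lt.1 (Complex.abs_arg_lt_pi_div_two_iff.2 (Or.inl hy))
  rw [Complex.cpow_def_of_ne_zero (mul_ne_zero hx0 hy0), Complex.cpow_def_of_ne_zero hx0,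
    Complex.cpow_def_of_ne_zero hy0, Complex.log_mul hx0 hy0 ⟨by linarith, by linarith⟩,
    add_mul, Complex.exp_add]

lemma I_half : Complex.I ^ (1 / 2 : ℂ) = Complex.exp (Real.pi * Complex.I * (1 / 4)) := by
  rw [Complex.cpow_def_of_ne_zero Complex.I_ne_zero, Complex.log_I]
  congr 1
  ring

lemma half_mul_I {x : ℂ} (hx : 0 < x.re) :
    (Complex.I * x) ^ (1 / 2 : ℂ) = Complex.exp (Real.pi * Complex.I * (1 / 4)) *
      x ^ (1 / 2 : ℂ) := by
  have hx0 : x ≠ 0 := by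
    rintro rfl
    simp at hx
  have h1 := abs_lt.1 (Complex.abs_arg_lt_pi_div_two_iff.2 (Or.inl hx))
  rw [← I_half, Complex.cpow_def_of_ne_zero (mul_ne_zero Complex.I_ne_zero hx0),
    Complex.cpow_def_of_ne_zero hx0, Complex.cpow_def_of_ne_zero Complex.I_ne_zero,
    Complex.log_mul Complex.I_ne_zero hx0
      (by rw [Complex.arg_I]; exact ⟨by linarith, by linarith⟩), add_mul, Complex.exp_add]

lemma eta_S (z : ℂ) (hz : 0 < z.im) :
    dedekindEta (-1 / z) = (-(Complex.I * z)) ^ (1 / 2 : ℂ) * dedekindEta z := by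
  have h := ModularForm.eta_comp_eq_csqrt_I_inv (show z ∈ UpperHalfPlane.upperHalfPlaneSet from hz)
  simp only [Function.comp, Pi.smul_apply, Pi.mul_apply, smul_eq_mul, Complex.sqrt] at h
  rw [eta_eq, eta_eq, h, ← mul_assoc]
  congr 1
  have h2 := half_mul_I (x := -(Complex.I * z)) (by simpa using hz)
  have h3 : Complex.I * -(Complex.I * z) = z := by
    linear_combination (-z) * Complex.I_sq
  rw [h3, ← I_half] at h2
  have hI : Complex.I ^ (1 / 2 : ℂ) ≠ 0 := by
    rw [I_half]
    exact Complex.exp_ne_zero _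
  rw [one_div] at *
  rw [h2]
  field_simp

def Claim (a b c d : ℤ) : Prop := ∀ z : ℂ, 0 < z.im →
    dedekindEta (((a : ℂ) * z + (b : ℂ)) / ((c : ℂ) * z + (d : ℂ))) =
      Complex.exp (Real.pi * Complex.I *
          (((a : ℂ) + (d : ℂ)) / (12 * (c : ℂ)) - (dedekindSum d c : ℝ))) *
        (-(Complex.I * ((c : ℂ) * z + (d : ℂ)))) ^ (1 / 2 : ℂ) * dedekindEta z

lemma claim_shift (a b c d k : ℤ) (hc : 0 < c) (h : Claim a b c d) :
    Claim a (b + a * k) c (d + c * k) := by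
  intro z hz
  have h1 := h (z + k) (by simpa using hz)
  have hc0 : (c : ℂ) ≠ 0 := by exact_mod_cast hc.ne'
  rw [dedekindSum_add_mul d c k hc]
  have e1 : ((a : ℂ) * z + ((b + a * k : ℤ) : ℂ)) = a * (z + k) + b := by
    push_cast
    ring
  have e2 : ((c : ℂ) * z + ((d + c * k : ℤ) : ℂ)) = c * (z + k) + d := by
    push_cast
    ring
  rw [e1, e2, h1, eta_add_int]
  have e3 : (Real.pi * Complex.I *
          (((a : ℂ) + ((d + c * k : ℤ) : ℂ)) / (12 * (c : ℂ)) - (dedekindSum d c : ℝ))) =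
      (Real.pi * Complex.I *
          (((a : ℂ) + (d : ℂ)) / (12 * (c : ℂ)) - (dedekindSum d c : ℝ))) +
      Real.pi * Complex.I * (k / 12) := by
    push_cast
    field_simp
    ring
  rw [e3, Complex.exp_add]
  ring

lemma claim_base (a : ℤ) : Claim a (-1) 1 0 := by
  intro z hz
  have hz0 : z ≠ 0 := by
    rintro rfl
    simp at hz
  have e : ((a : ℂ) * z + ((-1 : ℤ) : ℂ)) / (((1 : ℤ) : ℂ) * z + ((0 : ℤ) : ℂ)) = -1 / z + a := by
    push_cast
    rw [one_mul, add_zero]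
    field_simp
    ring
  have es : dedekindSum 0 1 = 0 := by simp [dedekindSum]
  rw [e, eta_add_int, eta_S z hz, es]
  push_cast
  simp only [add_zero, one_mul, mul_one, sub_zero]
  ring

lemma claim_step (a b : ℤ) (c d : ℕ) (hdet : a * d - b * c = 1) (hc : 0 < c) (hd : 0 < d)
    (h : Claim b (-a) d (-c)) : Claim a b c d := by
  intro z hz
  have hz0 : z ≠ 0 := by
    rintro rfl
    simp at hz
  have hc0 : (c : ℂ) ≠ 0 := by exact_mod_cast hc.ne'
  have hd0 : (d : ℂ) ≠ 0 := by exact_mod_cast hd.ne'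
  have hw : 0 < (-1 / z).im := by
    rw [neg_div, one_div, Complex.neg_im, Complex.inv_im, neg_div, neg_neg]
    exact div_pos hz (Complex.normSq_pos.2 hz0)
  have h1 := h (-1 / z) hw
  have hcz : (c : ℂ) * z + d ≠ 0 := by
    intro h0
    have := congrArg Complex.im h0
    simp at this
    rcases this with h | h
    · omega
    · exact hz.ne' h
  have e1 : ((b : ℂ) * (-1 / z) + ((-a : ℤ) : ℂ)) / (((d : ℤ) : ℂ) * (-1 / z) + ((-c : ℤ) : ℂ)) =
      (a * z + b) / (((c : ℤ) : ℂ) * z + ((d : ℤ) : ℂ)) := by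
    push_cast
    have e2 : (d : ℂ) * (-1 / z) + -c = - ((c : ℂ) * z + d) / z := by
      field_simp
      ring
    rw [e2]
    field_simp
    ring
  rw [e1] at h1
  rw [h1, eta_S z hz]
  have hco : Nat.Coprime d c := by
    rw [← Nat.isCoprime_iff_coprime]
    exact ⟨a, -b, by linarith⟩
  have hrec := reciprocity hco hc hd
  rw [dedekindSum_neg]
  have hsq : (-(Complex.I * (((d : ℤ) : ℂ) * (-1 / z) + ((-c : ℤ) : ℂ)))) ^ (1 / 2 : ℂ) *
      (-(Complex.I * z)) ^ (1 / 2 : ℂ) = Complex.exp (Real.pi * Complex.I * (1 / 4)) *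
      (-(Complex.I * (((c : ℤ) : ℂ) * z + ((d : ℤ) : ℂ)))) ^ (1 / 2 : ℂ) := by
    rw [← half_mul, ← half_mul_I]
    · congr 1
      push_cast
      field_simp
      linear_combination (0 : ℂ) * Complex.I_sq
    · simp
      positivity
    · have : (-(Complex.I * (((d : ℤ) : ℂ) * (-1 / z) + ((-c : ℤ) : ℂ)))).re = d * (-1 / z).im := by
        simp only [Complex.neg_re, Complex.mul_re, Complex.I_re, Complex.I_im, Complex.add_im,
          Complex.mul_im]
        simp
      rw [this]
      positivity
    · simpa using hz
  have hexp : (Real.pi * Complex.I * (((b : ℂ) + ((-c : ℤ) : ℂ)) / (12 * ((d : ℤ) : ℂ)) -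
      ((-dedekindSum c d : ℝ) : ℂ))) + Real.pi * Complex.I * (1 / 4) =
      Real.pi * Complex.I * (((a : ℂ) + ((d : ℤ) : ℂ)) / (12 * ((c : ℤ) : ℂ)) -
        ((dedekindSum d c : ℝ) : ℂ)) := by
    rw [← mul_add]
    congr 1
    have hr : ((dedekindSum d c : ℝ) : ℂ) + ((dedekindSum c d : ℝ) : ℂ) =
        -1 / 4 + ((d : ℂ) / c + (c : ℂ) / d + 1 / ((d : ℂ) * c)) / 12 := by
      have := congrArg (fun x : ℝ => (x : ℂ)) hrec
      push_cast at this
      exact this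
    have hdc : (a : ℂ) * d - b * c = 1 := by exact_mod_cast hdet
    have hs : ((dedekindSum c d : ℝ) : ℂ) =
        -1 / 4 + ((d : ℂ) / c + (c : ℂ) / d + ((a : ℂ) * d - b * c) / ((d : ℂ) * c)) / 12
          - ((dedekindSum d c : ℝ) : ℂ) := by
      rw [hdc, ← hr]
      ring
    push_cast
    rw [hs]
    field_simp
    ring
  rw [← hexp, Complex.exp_add]
  linear_combination (Complex.exp (Real.pi * Complex.I *
    (((b : ℂ) + ((-c : ℤ) : ℂ)) / (12 * ((d : ℤ) : ℂ)) - ((-dedekindSum c d : ℝ) : ℂ))) *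
      dedekindEta z) * hsq

lemma claim_all (n : ℕ) : ∀ a b d : ℤ, 0 < n → a * d - b * n = 1 → Claim a b n d := by
  induction n using Nat.strong_induction_on with
  | _ n ih =>
    intro a b d hn hdet
    have hn' : (0 : ℤ) < n := by exact_mod_cast hn
    set k := d / (n : ℤ) with hk
    have hdm : d % (n : ℤ) + n * k = d := Int.emod_add_mul_ediv d n
    have h0 := Int.emod_nonneg d hn'.ne'
    have h1 := Int.emod_lt_of_pos d hn'
    suffices H : Claim a (b - a * k) n (d % n) by
      have := claim_shift _ _ _ _ k hn' H
      rwa [sub_add_cancel, hdm] at this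
    have hdet' : a * (d % n) - (b - a * k) * n = 1 := by
      rw [← hdet]
      linear_combination a * hdm
    obtain ⟨m, hm⟩ := Int.eq_ofNat_of_zero_le h0
    rw [hm] at hdet' h1 ⊢
    rcases Nat.eq_zero_or_pos m with rfl | hmpos
    · have hn1 : (n : ℤ) = 1 := by
        have : (n : ℤ) ∣ 1 := ⟨-(b - a * k), by push_cast at hdet'; linarith⟩
        exact Int.eq_one_of_dvd_one hn'.le this
      rw [hn1] at hdet' ⊢
      have hb : b - a * k = -1 := by
        push_cast at hdet'
        linarith
      rw [hb]
      exact claim_base a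
    · refine claim_step a _ n m hdet' hn hmpos ?_
      exact ih m (by exact_mod_cast h1) _ _ _ hmpos (by linarith)

end EtaAux

/-- For every `A = (a b; c d) ∈ SL(2,ℤ)` with `c > 0` and every `z ∈ ℍ`,
`η((az+b)/(cz+d)) = exp(πi((a+d)/(12c) − s(d,c)))·(−i(cz+d))^{1/2}·η(z)`
with the principal branch of the square root. -/
theorem stmt8 (a b c d : ℤ) (hdet : a * d - b * c = 1) (hc : 0 < c)
    (z : ℂ) (hz : 0 < z.im) :
    dedekindEta (((a : ℂ) * z + (b : ℂ)) / ((c : ℂ) * z + (d : ℂ))) =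
      Complex.exp (Real.pi * Complex.I *
          (((a : ℂ) + (d : ℂ)) / (12 * (c : ℂ)) - (dedekindSum d c : ℝ))) *
        (-(Complex.I * ((c : ℂ) * z + (d : ℂ)))) ^ (1 / 2 : ℂ) * dedekindEta z := by
  obtain ⟨n, rfl⟩ := Int.eq_ofNat_of_zero_le hc.le
  exact EtaAux.claim_all n a b d (by exact_mod_cast hc) hdet z hz
end

section
/- Let (a b; c d) ∈ SL(2,ℤ) with c > 0, and set v_η = exp(πi((a+d)/(12c) − s(d,c) − 1/4)) (the weight-1/2 eta multiplier). If c is even, then v_η = (c/d)·e((1/24)[(a+d)c − bd(c²−1) + 3d − 3 − 3cd]); if c is odd, then v_η = (d/c)·e((1/24)[(a+d)c − bd(c²−1) − 3c]). Here (·/·) is the extended quadratic residue symbol. -/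
open Complex Real

/-- The extended quadratic residue symbol `(c/d)`: the usual Jacobi symbol for
`d` odd positive, extended to odd negative `d` by `(c/d) = sign(c)·(c/−d)` for
`c ≠ 0` and `(0/d) = 1` if `d = ±1`, `0` otherwise. -/
def extJacobi (c d : ℤ) : ℤ :=
  if 0 < d then jacobiSym c d.toNat
  else if c = 0 then (if d = 1 ∨ d = -1 then 1 else 0)
  else c.sign * jacobiSym c (-d).toNat

/-- `e(x) = e^{2πix}` of a rational number given as an integer divided by 24. -/
noncomputable def e24 (n : ℤ) : ℂ :=
  Complex.exp (2 * Real.pi * Complex.I * (n : ℂ) / 24)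

lemma saw_add_int (x : ℝ) (k : ℤ) : sawtooth (x + k) = sawtooth x := by
  unfold sawtooth
  rw [Int.floor_add_intCast]
  push_cast
  simp only [add_left_inj]
  split_ifs
  · rfl
  · ring

lemma saw_neg (x : ℝ) : sawtooth (-x) = - sawtooth x := by
  unfold sawtooth
  by_cases h : x = (⌊x⌋ : ℝ)
  · have h2 : -x = (⌊-x⌋ : ℝ) := by
      rw [h]
      have : (-(⌊x⌋ : ℝ)) = ((-⌊x⌋ : ℤ) : ℝ) := by push_cast; ring
      rw [this, Int.floor_intCast]
    rw [if_pos h2, if_pos h]; simp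
  · have h1 := Int.floor_le x
    have h3 := Int.lt_floor_add_one x
    have h4 : (⌊x⌋ : ℝ) < x := lt_of_le_of_ne h1 (fun hh => h hh.symm)
    have hf : ⌊-x⌋ = -⌊x⌋ - 1 := by
      rw [Int.floor_eq_iff]; push_cast; constructor <;> linarith
    have h2 : ¬ (-x = (⌊-x⌋ : ℝ)) := by
      rw [hf]; push_cast; intro h5; linarith
    rw [if_neg h2, if_neg h, hf]; push_cast; ring

lemma ded_shift (d c k : ℤ) (hc : 0 < c) : dedekindSum (d + k * c) c = dedekindSum d c := by
  unfold dedekindSum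
  refine Finset.sum_congr rfl fun n _ => ?_
  have hc' : (c : ℝ) ≠ 0 := by exact_mod_cast hc.ne'
  have : ((d + k * c : ℤ) : ℝ) * n / c = d * n / c + ((k * n : ℤ) : ℝ) := by
    push_cast; field_simp
  rw [this, saw_add_int]

lemma ded_neg (d c : ℤ) : dedekindSum (-d) c = - dedekindSum d c := by
  unfold dedekindSum
  rw [← Finset.sum_neg_distrib]
  refine Finset.sum_congr rfl fun n _ => ?_
  have : ((-d : ℤ) : ℝ) * n / c = - (d * n / c) := by push_cast; ring
  rw [this, saw_neg]; ring

lemma saw_nat (m c : ℕ) (hc : 0 < c) (h : ¬ c ∣ m) :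
    sawtooth ((m : ℝ) / c) = (m : ℝ) / c - ((m / c : ℕ) : ℝ) - 1 / 2 := by
  have hc' : (0 : ℝ) < c := by exact_mod_cast hc
  have hr : (m : ℝ) = c * ((m / c : ℕ) : ℝ) + ((m % c : ℕ) : ℝ) := by
    exact_mod_cast (Nat.div_add_mod m c).symm
  have hr0 : (0 : ℝ) < ((m % c : ℕ) : ℝ) := by
    have : 0 < m % c := Nat.pos_of_ne_zero fun h0 => h (Nat.dvd_of_mod_eq_zero h0)
    exact_mod_cast this
  have hrc : ((m % c : ℕ) : ℝ) < c := by exact_mod_cast Nat.mod_lt m hc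
  have hx : (m : ℝ) / c = ((m / c : ℕ) : ℝ) + ((m % c : ℕ) : ℝ) / c := by
    conv_lhs => rw [hr]
    field_simp
  have h1 : 0 < ((m % c : ℕ) : ℝ) / c := by positivity
  have h2 : ((m % c : ℕ) : ℝ) / c < 1 := by rw [div_lt_one hc']; exact hrc
  have hf : ⌊(m : ℝ) / c⌋ = ((m / c : ℕ) : ℤ) := by
    rw [Int.floor_eq_iff, hx, Int.cast_natCast]
    constructor
    · linarith
    · linarith
  unfold sawtooth
  rw [hf, if_neg]
  · rw [Int.cast_natCast]
  · rw [hx, Int.cast_natCast]; intro h5; linarith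

lemma ded_nat (d c : ℕ) (hc : 0 < c) (h : Nat.Coprime d c) :
    dedekindSum d c = ∑ n ∈ Finset.range c,
      ((n : ℝ) / c) * ((d : ℝ) * n / c - ((d * n / c : ℕ) : ℝ) - 1 / 2) := by
  unfold dedekindSum
  rw [Finset.range_eq_Ico, Finset.sum_eq_sum_Ico_succ_bot hc]
  simp only [Int.toNat_natCast, Nat.cast_zero, zero_div, zero_mul, zero_add]
  refine Finset.sum_congr rfl fun n hn => ?_
  rw [Finset.mem_Ico] at hn
  have hnd : ¬ c ∣ d * n := by
    intro hd
    have := (Nat.Coprime.dvd_of_dvd_mul_left h.symm hd)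
    exact absurd (Nat.le_of_dvd (by omega) this) (by omega)
  have := saw_nat (d * n) c hc hnd
  push_cast at this ⊢
  rw [this]

lemma sum_perm (d c : ℕ) (hc : 0 < c) (h : Nat.Coprime d c) (f : ℕ → ℝ) :
    ∑ n ∈ Finset.range c, f (d * n % c) = ∑ n ∈ Finset.range c, f n := by
  have hinj : Set.InjOn (fun n => d * n % c) (Finset.range c : Set ℕ) := by
    intro x hx y hy hxy
    simp only [Finset.coe_range, Set.mem_Iio] at hx hy
    have h1 : d * x ≡ d * y [MOD c] := hxy
    have h2 := Nat.ModEq.cancel_left_of_coprime (Nat.Coprime.symm h) h1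
    exact Nat.ModEq.eq_of_lt_of_lt h2 hx hy
  have himg : (Finset.range c).image (fun n => d * n % c) = Finset.range c := by
    apply Finset.eq_of_subset_of_card_le
    · intro y hy
      simp only [Finset.mem_image, Finset.mem_range] at hy ⊢
      obtain ⟨x, _, rfl⟩ := hy
      exact Nat.mod_lt _ hc
    · rw [Finset.card_image_of_injOn hinj]
  conv_rhs => rw [← himg]
  rw [Finset.sum_image hinj]

lemma sum1 (c : ℕ) : ∑ n ∈ Finset.range c, (n : ℝ) = c * (c - 1) / 2 := by
  induction c with
  | zero => simp
  | succ k ih => rw [Finset.sum_range_succ, ih]; push_cast; ring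

lemma sum2 (c : ℕ) : ∑ n ∈ Finset.range c, (n : ℝ) ^ 2 = c * (c - 1) * (2 * c - 1) / 6 := by
  induction c with
  | zero => simp
  | succ k ih => rw [Finset.sum_range_succ, ih]; push_cast; ring

lemma sumq (d c : ℕ) (hc : 0 < c) (h : Nat.Coprime d c) :
    ∑ n ∈ Finset.range c, ((d * n / c : ℕ) : ℝ) = (c - 1) * (d - 1) / 2 := by
  have hc' : (c : ℝ) ≠ 0 := by exact_mod_cast hc.ne'
  have h1 := sum_perm d c hc h (fun n => (n : ℝ))
  have h2 : ∀ n, ((d * n % c : ℕ) : ℝ) = d * n - c * ((d * n / c : ℕ) : ℝ) := by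
    intro n
    have : ((c * (d * n / c) + d * n % c : ℕ) : ℝ) = (d * n : ℕ) := by
      rw [Nat.div_add_mod]
    push_cast at this ⊢
    linarith
  simp only [h2, Finset.sum_sub_distrib, ← Finset.mul_sum, sum1] at h1
  apply mul_left_cancel₀ hc'
  linarith

lemma sumq2 (d c : ℕ) (hc : 0 < c) (h : Nat.Coprime d c) :
    (c : ℝ) * (c - 1) * (2 * c - 1) / 6 * (d ^ 2 - 1) - 2 * d * c *
      ∑ n ∈ Finset.range c, (n : ℝ) * ((d * n / c : ℕ) : ℝ)
      + c ^ 2 * ∑ n ∈ Finset.range c, ((d * n / c : ℕ) : ℝ) ^ 2 = 0 := by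
  have h1 := sum_perm d c hc h (fun n => (n : ℝ) ^ 2)
  have h2 : ∀ n, ((d * n % c : ℕ) : ℝ) ^ 2 = d ^ 2 * n ^ 2 - 2 * d * c * (n * ((d * n / c : ℕ) : ℝ))
      + c ^ 2 * ((d * n / c : ℕ) : ℝ) ^ 2 := by
    intro n
    have : ((c * (d * n / c) + d * n % c : ℕ) : ℝ) = (d * n : ℕ) := by
      rw [Nat.div_add_mod]
    have h3 : ((d * n % c : ℕ) : ℝ) = d * n - c * ((d * n / c : ℕ) : ℝ) := by
      push_cast at this ⊢
      linarith
    rw [h3]; ring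
  simp only [h2, Finset.sum_sub_distrib, Finset.sum_add_distrib, ← Finset.mul_sum, sum2] at h1
  linarith

lemma card_filt (d c m : ℕ) (hc : 0 < c) (hd : 0 < d) (h : Nat.Coprime d c) (hm : 0 < m)
    (hmd : m < d) :
    ((Finset.range c).filter (fun n => m ≤ d * n / c)) = Finset.Ico (c * m / d + 1) c := by
  ext n
  simp only [Finset.mem_filter, Finset.mem_range, Finset.mem_Ico, Nat.le_div_iff_mul_le hc]
  rw [Nat.succ_le_iff, Nat.div_lt_iff_lt_mul hd]
  have hne : c * m ≠ n * d := by
    intro he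
    have : d ∣ c * m := ⟨n, by rw [he, mul_comm]⟩
    have := Nat.Coprime.dvd_of_dvd_mul_left h this
    exact absurd (Nat.le_of_dvd hm this) (by omega)
  rw [mul_comm m c, mul_comm d n]
  constructor
  · rintro ⟨h1, h2⟩; exact ⟨lt_of_le_of_ne h2 hne, h1⟩
  · rintro ⟨h1, h2⟩; exact ⟨h2, h1.le⟩

lemma lattice (d c : ℕ) (hc : 0 < c) (hd : 0 < d) (h : Nat.Coprime d c) :
    ∑ n ∈ Finset.range c, (((d * n / c : ℕ) : ℝ) ^ 2 + ((d * n / c : ℕ) : ℝ)) =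
      2 * ∑ m ∈ Finset.range d, (m : ℝ) * (c - 1 - ((c * m / d : ℕ) : ℝ)) := by
  have h1 : ∀ n ∈ Finset.range c, (((d * n / c : ℕ) : ℝ) ^ 2 + ((d * n / c : ℕ) : ℝ)) =
      2 * ∑ m ∈ Finset.range d, if m ≤ d * n / c then (m : ℝ) else 0 := by
    intro n hn
    rw [Finset.mem_range] at hn
    have hq : d * n / c < d := by
      rw [Nat.div_lt_iff_lt_mul hc]
      exact Nat.mul_lt_mul_of_pos_left hn hd
    rw [← Finset.sum_filter]
    have : (Finset.range d).filter (fun m => m ≤ d * n / c) = Finset.range (d * n / c + 1) := by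
      ext m; simp only [Finset.mem_filter, Finset.mem_range]; omega
    rw [this, sum1]; push_cast; ring
  rw [Finset.sum_congr rfl h1, ← Finset.mul_sum, Finset.sum_comm]
  congr 1
  refine Finset.sum_congr rfl fun m hm => ?_
  rw [Finset.mem_range] at hm
  rcases Nat.eq_zero_or_pos m with rfl | hm0
  · simp
  rw [← Finset.sum_filter, card_filt d c m hc hd h hm0 hm]
  have hlt : c * m / d + 1 ≤ c := by
    rw [Nat.succ_le_iff, Nat.div_lt_iff_lt_mul hd]
    exact Nat.mul_lt_mul_of_pos_left hm hc
  rw [Finset.sum_const, Nat.card_Ico, nsmul_eq_mul, Nat.cast_sub hlt]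
  push_cast; ring

lemma ded_closed (d c : ℕ) (hc : 0 < c) (h : Nat.Coprime d c) :
    (c : ℝ) * dedekindSum d c = d * (c - 1) * (2 * c - 1) / 6 - c * (c - 1) / 4
      - ∑ n ∈ Finset.range c, (n : ℝ) * ((d * n / c : ℕ) : ℝ) := by
  have hc' : (c : ℝ) ≠ 0 := by exact_mod_cast hc.ne'
  rw [ded_nat d c hc h, Finset.mul_sum]
  have : ∀ n ∈ Finset.range c, (c : ℝ) * (((n : ℝ) / c) * ((d : ℝ) * n / c - ((d * n / c : ℕ) : ℝ) - 1 / 2))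
      = d / c * (n : ℝ) ^ 2 - (n : ℝ) * ((d * n / c : ℕ) : ℝ) - 1 / 2 * n := by
    intro n _
    field_simp
  rw [Finset.sum_congr rfl this, Finset.sum_sub_distrib, Finset.sum_sub_distrib, ← Finset.mul_sum,
    ← Finset.mul_sum, sum1, sum2]
  field_simp
  ring

lemma reciprocity (d c : ℕ) (hc : 0 < c) (hd : 0 < d) (h : Nat.Coprime d c) :
    12 * (c : ℝ) * d * (dedekindSum d c + dedekindSum c d) = d ^ 2 + c ^ 2 + 1 - 3 * c * d := by
  have hc' : (c : ℝ) ≠ 0 := by exact_mod_cast hc.ne'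
  have e1 := ded_closed d c hc h
  have e2 := ded_closed c d hd h.symm
  have e3 := sumq2 d c hc h
  have e4 := lattice d c hc hd h
  have e5 := sumq d c hc h
  have e6 : ∑ m ∈ Finset.range d, (m : ℝ) * (c - 1 - ((c * m / d : ℕ) : ℝ)) =
      (c - 1) * (d * (d - 1) / 2) - ∑ m ∈ Finset.range d, (m : ℝ) * ((c * m / d : ℕ) : ℝ) := by
    rw [← sum1, Finset.mul_sum, ← Finset.sum_sub_distrib]
    refine Finset.sum_congr rfl fun m _ => ?_
    ring
  rw [Finset.sum_add_distrib, e5, e6] at e4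
  apply mul_left_cancel₀ hc'
  linear_combination 12 * c * d * e1 + 12 * c ^ 2 * e2 + 6 * e3 - 6 * c ^ 2 * e4

/-- The Rademacher-type function. -/
noncomputable def etaPhi (a c d : ℤ) : ℝ := ((a : ℝ) + d) / c - 12 * dedekindSum d c

lemma phi_shift (a c d k : ℤ) (hc : 0 < c) : etaPhi a c (d + k * c) = etaPhi a c d + k := by
  have hc' : (c : ℝ) ≠ 0 := by exact_mod_cast hc.ne'
  unfold etaPhi
  rw [ded_shift d c k hc]; push_cast; field_simp; ring

lemma phi_neg (a c d : ℤ) : etaPhi (-a) c (-d) = - etaPhi a c d := by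
  unfold etaPhi
  rw [ded_neg]; push_cast; ring

lemma phi_S (a b : ℤ) (c d : ℕ) (h : a * d - b * c = 1) (hc : 0 < c) (hd : 0 < d)
    (hcop : Nat.Coprime d c) : etaPhi a c d = etaPhi b d (-c) + 3 := by
  have hc' : (c : ℝ) ≠ 0 := by exact_mod_cast hc.ne'
  have hd' : (d : ℝ) ≠ 0 := by exact_mod_cast hd.ne'
  have hr := reciprocity d c hc hd hcop
  have h' : (a : ℝ) * d - b * c = 1 := by exact_mod_cast h
  unfold etaPhi
  rw [ded_neg]
  apply mul_left_cancel₀ (mul_ne_zero hc' hd')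
  push_cast
  field_simp
  linear_combination h' - hr

lemma cop_of_det (a b : ℤ) (c d : ℕ) (h : a * d - b * c = 1) : Nat.Coprime d c := by
  have : IsCoprime (d : ℤ) (c : ℤ) := ⟨a, -b, by linarith⟩
  exact Nat.isCoprime_iff_coprime.mp this

lemma odd24 (c : ℤ) (hc : Odd c) : (24 : ℤ) ∣ c * (c ^ 2 - 1) := by
  have h8 : (8 : ℤ) ∣ c * (c ^ 2 - 1) := by
    exact Dvd.dvd.mul_left (Int.eight_dvd_sq_sub_one_of_odd hc) c
  have h3 : (3 : ℤ) ∣ c * (c ^ 2 - 1) := by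
    apply Int.dvd_of_emod_eq_zero
    have : c % 3 = 0 ∨ c % 3 = 1 ∨ c % 3 = 2 := by omega
    rcases this with h | h | h <;> simp [Int.mul_emod, Int.sub_emod, pow_two, h]
  omega

lemma chi4_nat (c : ℕ) (hc : Odd c) :
    (c % 4 = 1 ∧ ZMod.χ₄ c = 1) ∨ (c % 4 = 3 ∧ ZMod.χ₄ c = -1) := by
  rcases Nat.odd_mod_four_iff.mp (Nat.odd_iff.mp hc) with h | h
  · exact Or.inl ⟨h, ZMod.χ₄_nat_one_mod_four h⟩
  · exact Or.inr ⟨h, ZMod.χ₄_nat_three_mod_four h⟩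

/-- The congruence for odd `c`. -/
def OddClaim (a b : ℤ) (c : ℕ) (d : ℤ) : Prop :=
  ∃ k : ℤ, etaPhi a c d =
    (((a + d) * c - b * d * ((c : ℤ) ^ 2 - 1) - 3 * c + 3 + 6 * (1 - jacobiSym d c) + 24 * k : ℤ) : ℝ)

lemma claim_neg (a b : ℤ) (c : ℕ) (d : ℤ) (h : a * d - b * c = 1) (hc : Odd c)
    (H : OddClaim a b c d) : OddClaim (-a) b c (-d) := by
  obtain ⟨k, hk⟩ := H
  have hJ : jacobiSym d c = 1 ∨ jacobiSym d c = -1 := by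
    apply jacobiSym.eq_one_or_neg_one
    exact Int.isCoprime_iff_gcd_eq_one.mp ⟨a, -b, by linarith⟩
  have key : (24 : ℤ) ∣ -6 * (c : ℤ) + 18 - 6 * (jacobiSym d c + jacobiSym (-d) c) := by
    rw [jacobiSym.neg d hc]
    rcases chi4_nat c hc with ⟨h4, hx⟩ | ⟨h4, hx⟩ <;> rw [hx] <;> rcases hJ with hJ | hJ <;> rw [hJ] <;>
      omega
  obtain ⟨m, hm⟩ := key
  refine ⟨-k - m, ?_⟩
  rw [phi_neg, hk, ← Int.cast_neg]
  congr 1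
  linear_combination -hm

lemma odd_shift (a b : ℤ) (c : ℕ) (d t : ℤ) (h : a * d - b * c = 1) (hc : Odd c)
    (H : OddClaim a b c d) : OddClaim a (b + t * a) c (d + t * c) := by
  obtain ⟨k, hk⟩ := H
  obtain ⟨m, hm⟩ := odd24 c (by exact_mod_cast hc)
  refine ⟨k + m * (2 * t * b + t ^ 2 * a), ?_⟩
  have hJ : jacobiSym (d + t * c) c = jacobiSym d c := by
    apply jacobiSym.mod_left'
    simp
  rw [phi_shift a c d t (by exact_mod_cast hc.pos), hk, hJ, ← Int.cast_add]
  congr 1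
  linear_combination (t * ((c : ℤ) ^ 2 - 1)) * h + (2 * t * b + t ^ 2 * a) * hm

lemma odd_S (a b : ℤ) (c d : ℕ) (h : a * d - b * c = 1) (hc : Odd c) (hd : Odd d)
    (H : OddClaim b (-a) d (-c)) : OddClaim a b c d := by
  obtain ⟨k, hk⟩ := H
  have hcop := cop_of_det a b c d h
  have hJ : jacobiSym d c = 1 ∨ jacobiSym d c = -1 := by
    apply jacobiSym.eq_one_or_neg_one
    simpa using hcop
  have key : (24 : ℤ) ∣ 3 * (((c : ℤ) + 1) * (d - 1)) - 6 * (jacobiSym d c - jacobiSym (-c) d) := by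
    rw [jacobiSym.neg c hd]
    rw [← jacobiSym.quadratic_reciprocity_if (Nat.odd_iff.mp hd) (Nat.odd_iff.mp hc)] at hJ ⊢
    generalize jacobiSym c d = j at hJ ⊢
    obtain ⟨u, hu⟩ : ∃ u : ℤ, (c : ℤ) = 4 * u + (c % 4 : ℕ) := ⟨(c / 4 : ℕ), by omega⟩
    obtain ⟨v, hv⟩ : ∃ v : ℤ, (d : ℤ) = 4 * v + (d % 4 : ℕ) := ⟨(d / 4 : ℕ), by omega⟩
    rcases chi4_nat c hc with ⟨h4, hx⟩ | ⟨h4, hx⟩ <;>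
    rcases chi4_nat d hd with ⟨h4', hx'⟩ | ⟨h4', hx'⟩ <;>
    rw [hx', hu, hv] <;> simp only [h4, h4'] at hJ ⊢ <;> norm_num at hJ ⊢ <;>
    ring_nf <;> omega
  obtain ⟨m, hm⟩ := key
  refine ⟨k - m, ?_⟩
  rw [phi_S a b c d h hc.pos hd.pos hcop, hk]
  rw [show (3 : ℝ) = ((3 : ℤ) : ℝ) by norm_num, ← Int.cast_add]
  congr 1
  linear_combination (-(c : ℤ) * d) * h - hm

lemma odd_all : ∀ (c : ℕ), Odd c → ∀ a b d : ℤ, a * d - b * c = 1 → OddClaim a b c d := by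
  intro c
  induction c using Nat.strong_induction_on with
  | _ c ih =>
  intro hc a b d h
  have hcpos := hc.pos
  by_cases hc1 : c = 1
  · subst hc1
    refine ⟨0, ?_⟩
    simp [etaPhi, dedekindSum]
  -- the case of odd d with 0 < d < c
  have main : ∀ (a b : ℤ) (d : ℕ), a * d - b * c = 1 → Odd d → d < c → OddClaim a b c d := by
    intro a b d h hd hdc
    apply odd_S a b c d h hc hd
    apply ih d hdc hd
    linarith
  set d0 := d % c with hd0
  have hd0' : d = d0 + (d / c) * c := by
    have := Int.emod_add_mul_ediv d c
    linarith
  have hnn : 0 ≤ d0 := Int.emod_nonneg _ (by omega)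
  have hlt : d0 < c := Int.emod_lt_of_pos _ (by omega)
  set t := d / c
  clear_value d0 t
  obtain ⟨e, rfl⟩ := Int.eq_ofNat_of_zero_le hnn
  have h0 : a * e - (b - t * a) * c = 1 := by rw [hd0'] at h; linarith
  have goal0 : OddClaim a (b - t * a) c e → OddClaim a b c d := by
    intro H
    have := odd_shift a (b - t * a) c e t h0 hc H
    rw [← hd0'] at this
    simpa using this
  apply goal0
  by_cases he : Odd e
  · exact main _ _ _ h0 he (by exact_mod_cast hlt)
  · have hec : e < c := by exact_mod_cast hlt
    have he' := Nat.not_odd_iff_even.mp he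
    obtain ⟨f, hf⟩ : ∃ f, f = c - e := ⟨_, rfl⟩
    have hfo : Odd f := by rw [hf]; exact Nat.Odd.sub_even hec.le hc he'
    have hfc : (f : ℤ) = c - e := by omega
    have he0 : e ≠ 0 := by
      rintro rfl
      have : (c : ℤ) ∣ 1 := ⟨-(b - t * a), by push_cast at h0; linarith⟩
      have := Int.le_of_dvd one_pos this
      omega
    have h1 : (-a) * f - (b - t * a - a) * c = 1 := by rw [hfc]; linarith
    have H := main (-a) (b - t * a - a) f h1 hfo (by omega)
    have H2 := claim_neg _ _ _ _ h1 hc H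
    have h2 : - -a * -(f : ℤ) - (b - t * a - a) * c = 1 := by linarith
    have H3 := odd_shift _ _ _ _ 1 h2 hc H2
    have e1 : -(f : ℤ) + 1 * c = e := by omega
    rw [e1] at H3
    simpa using H3

lemma even_pos (a b : ℤ) (c d : ℕ) (h : a * d - b * c = 1) (hc : 0 < c) (hd : Odd d) :
    ∃ k : ℤ, etaPhi a c d =
    (((a + d) * c - b * d * ((c : ℤ) ^ 2 - 1) + 3 * d - 3 - 3 * c * d + 3
      + 6 * (1 - jacobiSym c d) + 24 * k : ℤ) : ℝ) := by
  obtain ⟨k, hk⟩ := odd_all d hd b (-a) (-c) (by linarith)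
  have hcop := cop_of_det a b c d h
  have hJ : jacobiSym c d = 1 ∨ jacobiSym c d = -1 := by
    apply jacobiSym.eq_one_or_neg_one
    simpa using hcop.symm
  have key : (24 : ℤ) ∣ 6 * ((d : ℤ) - 1) - 6 * (jacobiSym c d - jacobiSym (-c) d) := by
    rw [jacobiSym.neg c hd]
    rcases chi4_nat d hd with ⟨h4, hx⟩ | ⟨h4, hx⟩ <;> rw [hx] <;> rcases hJ with hJ | hJ <;> rw [hJ] <;>
      omega
  obtain ⟨m, hm⟩ := key
  refine ⟨k - m, ?_⟩
  rw [phi_S a b c d h hc hd.pos hcop, hk]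
  rw [show (3 : ℝ) = ((3 : ℤ) : ℝ) by norm_num, ← Int.cast_add]
  congr 1
  linear_combination (-(c : ℤ) * d) * h - hm

lemma e24_of_phi (a c d X J k : ℤ) (hJ : J = 1 ∨ J = -1)
    (h : etaPhi a c d = ((X + 3 + 6 * (1 - J) + 24 * k : ℤ) : ℝ)) :
    Complex.exp (Real.pi * Complex.I *
          (((a : ℂ) + (d : ℂ)) / (12 * (c : ℂ)) - (dedekindSum d c : ℝ) - 1 / 4)) =
        (J : ℂ) * e24 X := by
  have hC : (((a : ℂ) + d) / c - 12 * (dedekindSum d c : ℝ)) = ((X + 3 + 6 * (1 - J) + 24 * k : ℤ) : ℂ) := by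
    have := congrArg (fun x : ℝ => (x : ℂ)) h
    unfold etaPhi at this
    push_cast at this ⊢
    exact this
  have e1 : Real.pi * Complex.I *
      (((a : ℂ) + (d : ℂ)) / (12 * (c : ℂ)) - (dedekindSum d c : ℝ) - 1 / 4) =
      2 * Real.pi * Complex.I * (X : ℂ) / 24 + Real.pi * Complex.I * (1 - J) / 2
        + k * (2 * Real.pi * Complex.I) := by
    have e2 : ((a : ℂ) + (d : ℂ)) / (12 * (c : ℂ)) = (((a : ℂ) + d) / c) / 12 := by
      rw [div_div, mul_comm (12 : ℂ)]
    rw [e2]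
    push_cast at hC
    linear_combination (Real.pi * Complex.I / 12) * hC
  rw [e1, Complex.exp_add, Complex.exp_add, Complex.exp_int_mul_two_pi_mul_I, mul_one, mul_comm]
  unfold e24
  congr 1
  rcases hJ with rfl | rfl
  · simp
  · have : (Real.pi : ℂ) * Complex.I * (1 - ((-1 : ℤ) : ℂ)) / 2 = Real.pi * Complex.I := by
      push_cast; ring
    rw [this, Complex.exp_pi_mul_I]; simp

/-- Knopp / van Lint's formula for the weight-1/2 eta multiplier
`v_η = exp(πi((a+d)/(12c) − s(d,c) − 1/4))` on `(a b; c d) ∈ SL(2,ℤ)`, `c > 0`: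
if `c` is even, `v_η = (c/d)·e((1/24)[(a+d)c − bd(c²−1) + 3d − 3 − 3cd])`, and
if `c` is odd, `v_η = (d/c)·e((1/24)[(a+d)c − bd(c²−1) − 3c])`. -/
theorem stmt9 (a b c d : ℤ) (hdet : a * d - b * c = 1) (hc : 0 < c) :
    (Even c →
      Complex.exp (Real.pi * Complex.I *
          (((a : ℂ) + (d : ℂ)) / (12 * (c : ℂ)) - (dedekindSum d c : ℝ) - 1 / 4)) =
        (extJacobi c d : ℂ) * e24 ((a + d) * c - b * d * (c ^ 2 - 1) + 3 * d - 3 - 3 * c * d)) ∧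
    (Odd c →
      Complex.exp (Real.pi * Complex.I *
          (((a : ℂ) + (d : ℂ)) / (12 * (c : ℂ)) - (dedekindSum d c : ℝ) - 1 / 4)) =
        (extJacobi d c : ℂ) * e24 ((a + d) * c - b * d * (c ^ 2 - 1) - 3 * c)) := by
  constructor
  · intro hev
    obtain ⟨n, rfl⟩ := Int.eq_ofNat_of_zero_le hc.le
    have hn : 0 < n := by exact_mod_cast hc
    have hdo : Odd d := by
      by_contra hd
      rw [Int.not_odd_iff_even] at hd
      have : Even (a * d - b * (n : ℤ)) := (hd.mul_left a).sub (hev.mul_left b)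
      rw [hdet] at this
      exact absurd this (by decide)
    rcases lt_or_ge 0 d with hd | hd
    · obtain ⟨m, rfl⟩ := Int.eq_ofNat_of_zero_le hd.le
      obtain ⟨k, hk⟩ := even_pos a b n m hdet hn (by exact_mod_cast hdo)
      have hJ : extJacobi n m = jacobiSym n m := by
        unfold extJacobi; rw [if_pos hd, Int.toNat_natCast]
      rw [hJ]
      refine e24_of_phi a n m _ _ k ?_ hk
      apply jacobiSym.eq_one_or_neg_one
      simpa using (cop_of_det a b n m hdet).symm
    · obtain ⟨m, hm⟩ := Int.eq_ofNat_of_zero_le (neg_nonneg.mpr hd)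
      have hdm : d = -(m : ℤ) := by omega
      subst hdm
      have hdet' : -a * m - b * n = 1 := by linarith
      have hmo : Odd m := by
        have := hdo.neg
        rw [neg_neg] at this
        exact_mod_cast this
      obtain ⟨k, hk⟩ := even_pos (-a) b n m hdet' hn hmo
      have hJ : extJacobi n (-(m : ℤ)) = jacobiSym n m := by
        unfold extJacobi
        rw [if_neg (by omega), if_neg (by omega), Int.sign_eq_one_of_pos hc, neg_neg,
          Int.toNat_natCast, one_mul]
      have hJ1 : jacobiSym n m = 1 ∨ jacobiSym n m = -1 := by
        apply jacobiSym.eq_one_or_neg_one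
        simpa using (cop_of_det (-a) b n m hdet').symm
      rw [hJ]
      obtain ⟨l, hl⟩ : ∃ l : ℤ, 1 - jacobiSym n m = 2 * l := by
        rcases hJ1 with h | h <;> rw [h]
        · exact ⟨0, rfl⟩
        · exact ⟨1, rfl⟩
      refine e24_of_phi a n _ _ _ (-k - l) hJ1 ?_
      have := phi_neg (-a) n m
      rw [neg_neg] at this
      rw [this, hk, ← Int.cast_neg]
      congr 1
      linear_combination (-12) * hl
  · intro hodd
    obtain ⟨n, rfl⟩ := Int.eq_ofNat_of_zero_le hc.le
    obtain ⟨k, hk⟩ := odd_all n (by exact_mod_cast hodd) a b d hdet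
    have hJ : extJacobi d n = jacobiSym d n := by
      unfold extJacobi; rw [if_pos hc, Int.toNat_natCast]
    rw [hJ]
    refine e24_of_phi a n d _ _ k ?_ hk
    apply jacobiSym.eq_one_or_neg_one
    exact Int.isCoprime_iff_gcd_eq_one.mp ⟨a, -b, by linarith⟩
end

section
/- For every matrix A = (a b; c d) ∈ SL(2,ℤ) with c ≡ 0 (mod 4) and every z in the upper half-plane ℍ, the Jacobi theta function satisfies θ((az+b)/(cz+d)) = ε_d^{−1}·(c/d)·(cz+d)^{1/2}·θ(z), where (cz+d)^{1/2} denotes the principal branch of the square root. -/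
open Complex Real

/-- The Jacobi theta function `θ(z) = Σ_{n∈ℤ} e(n²z)`, `e(x) = e^{2πix}`. -/
noncomputable def jacobiThetaE (z : ℂ) : ℂ :=
  ∑' n : ℤ, Complex.exp (2 * Real.pi * Complex.I * (n : ℂ) ^ 2 * z)

/-- `ε_d = 1` if `d ≡ 1 (mod 4)`, `ε_d = i` if `d ≡ −1 (mod 4)`. -/
noncomputable def epsFactor (d : ℤ) : ℂ :=
  if d % 4 = 1 then 1 else Complex.I

lemma cpow_mul_good {w₁ w₂ : ℂ} (h₁ : w₁ ≠ 0) (h₂ : w₂ ≠ 0) (hl : -π < arg w₁ + arg w₂)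
    (hu : arg w₁ + arg w₂ ≤ π) :
    (w₁ * w₂) ^ (1 / 2 : ℂ) = w₁ ^ (1 / 2 : ℂ) * w₂ ^ (1 / 2 : ℂ) := by
  rw [cpow_def_of_ne_zero h₁, cpow_def_of_ne_zero h₂, cpow_def_of_ne_zero (mul_ne_zero h₁ h₂),
    ← Complex.exp_add]
  have : Complex.log (w₁ * w₂) = Complex.log w₁ + Complex.log w₂ := by
    rw [← Complex.log_exp (x := Complex.log w₁ + Complex.log w₂) (by simpa [log_im] using hl)
      (by simpa [log_im] using hu), Complex.exp_add, Complex.exp_log h₁, Complex.exp_log h₂]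
  rw [this]; ring_nf

lemma cpow_mul_bad {w₁ w₂ : ℂ} (h₁ : w₁ ≠ 0) (h₂ : w₂ ≠ 0) (hl : π < arg w₁ + arg w₂) :
    (w₁ * w₂) ^ (1 / 2 : ℂ) = -(w₁ ^ (1 / 2 : ℂ) * w₂ ^ (1 / 2 : ℂ)) := by
  rw [cpow_def_of_ne_zero h₁, cpow_def_of_ne_zero h₂, cpow_def_of_ne_zero (mul_ne_zero h₁ h₂),
    ← Complex.exp_add]
  have : Complex.log (w₁ * w₂) = Complex.log w₁ + Complex.log w₂ - 2 * π * I := by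
    rw [← Complex.log_exp (x := Complex.log w₁ + Complex.log w₂ - 2 * π * I)
      (by simp [log_im]; linarith)
      (by simp [log_im]; linarith [arg_le_pi w₁, arg_le_pi w₂, Real.pi_pos]),
      Complex.exp_sub, Complex.exp_add, Complex.exp_log h₁, Complex.exp_log h₂,
      Complex.exp_two_pi_mul_I, div_one]
  rw [this]
  have e : (Complex.log w₁ + Complex.log w₂ - 2 * π * I) * (1 / 2) =
    (Complex.log w₁ * (1 / 2) + Complex.log w₂ * (1 / 2)) - π * I := by ring
  rw [e, Complex.exp_sub, Complex.exp_pi_mul_I, div_neg, div_one]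

lemma mul_im_polar (w₁ w₂ : ℂ) :
    (w₁ * w₂).im = ‖w₁‖ * ‖w₂‖ * Real.sin (arg w₁ + arg w₂) := by
  rw [mul_im, Real.sin_add, ← norm_mul_cos_arg w₁, ← norm_mul_cos_arg w₂, ← norm_mul_sin_arg w₁,
    ← norm_mul_sin_arg w₂]
  ring

lemma mul_re_polar (w₁ w₂ : ℂ) :
    (w₁ * w₂).re = ‖w₁‖ * ‖w₂‖ * Real.cos (arg w₁ + arg w₂) := by
  rw [mul_re, Real.cos_add, ← norm_mul_cos_arg w₁, ← norm_mul_cos_arg w₂, ← norm_mul_sin_arg w₁,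
    ← norm_mul_sin_arg w₂]
  ring

lemma thetaE_eq (z : ℂ) : jacobiThetaE z = jacobiTheta₂ 0 (2 * z) :=
  tsum_congr fun n => by simp only [jacobiTheta₂_term]; congr 1; ring

lemma thetaE_add_one (z : ℂ) : jacobiThetaE (z + 1) = jacobiThetaE z := by
  rw [thetaE_eq, thetaE_eq, mul_add, mul_one, jacobiTheta₂_add_right]

lemma four_ne {z : ℂ} (hz : 0 < z.im) : 4 * z + 1 ≠ 0 := by
  intro h
  have := congrArg Complex.im h
  simp at this
  exact hz.ne' this

lemma im_V {z : ℂ} (hz : 0 < z.im) : 0 < (z / (4 * z + 1)).im := by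
  have h := normSq_pos.2 (four_ne hz)
  have : (z / (4 * z + 1)).im = z.im / normSq (4 * z + 1) := by
    rw [div_im]; simp; field_simp; ring
  rw [this]; positivity

lemma thetaE_V {z : ℂ} (hz : 0 < z.im) :
    jacobiThetaE (z / (4 * z + 1)) = (4 * z + 1) ^ (1 / 2 : ℂ) * jacobiThetaE z := by
  have h4 := four_ne hz
  have hz0 : z ≠ 0 := by rintro rfl; simp at hz
  have hV := im_V hz
  have e1 := jacobiTheta₂_functional_equation 0 (2 * (z / (4 * z + 1)))
  have e2 := jacobiTheta₂_functional_equation 0 (2 * z)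
  have e3 : -1 / (2 * z) = -1 / (2 * (z / (4 * z + 1))) + 2 := by
    field_simp; ring
  rw [e3] at e2
  simp only [zero_div, jacobiTheta₂_add_right] at e2 e1
  rw [thetaE_eq, thetaE_eq, e1, e2]
  set w₁ := 4 * z + 1 with hw₁
  set w₂ := -I * (2 * (z / w₁)) with hw₂
  have hw20 : w₂ ≠ 0 := by simp [hw₂, hz0, h4]
  have hprod : -I * (2 * z) = w₁ * w₂ := by rw [hw₂]; field_simp
  have hre1 : 0 < (w₁ * w₂).re := by rw [← hprod]; simp [hz]
  have hre2 : 0 < w₂.re := by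
    have : w₂.re = 2 * (z / w₁).im := by rw [hw₂, neg_mul, neg_re, I_mul_re]; simp
    rw [this]; linarith
  have hi1 : 0 < w₁.im := by simp [hw₁, hz]
  have ha2 := abs_lt.1 (abs_arg_lt_pi_div_two_iff.2 (Or.inl hre2))
  have ha1 := arg_nonneg_iff.2 hi1.le
  have ha1' := arg_le_pi w₁
  have hs : arg w₁ + arg w₂ ≤ π := by
    by_contra! hcon
    rw [mul_re_polar] at hre1
    have hc : Real.cos (arg w₁ + arg w₂) ≤ 0 :=
      Real.cos_nonpos_of_pi_div_two_le_of_le (by linarith [Real.pi_pos]) (by linarith)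
    have := mul_nonneg (norm_nonneg w₁) (norm_nonneg w₂)
    nlinarith
  rw [hprod, cpow_mul_good h4 hw20 (by linarith [Real.pi_pos]) hs]
  have hh1 : w₁ ^ (1 / 2 : ℂ) ≠ 0 := by simp [cpow_eq_zero_iff, h4]
  have hh2 : w₂ ^ (1 / 2 : ℂ) ≠ 0 := by simp [cpow_eq_zero_iff, hw20]
  simp
  field_simp

lemma J_four (a : ℤ) {m : ℕ} (hm : Odd m) : jacobiSym (4 * a) m = jacobiSym a m := by
  rw [jacobiSym.mul_left, jacobiSym.at_four hm, one_mul]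

lemma J_period (a : ℤ) {m n : ℕ} (hm : Odd m) (hn : Odd n) (h : 4 * a ∣ (m : ℤ) - n) :
    jacobiSym a m = jacobiSym a n := by
  have h' : m % (4 * a.natAbs) = n % (4 * a.natAbs) := by
    have : n ≡ m [MOD (4 * a.natAbs)] := by
      rw [Nat.modEq_iff_dvd]
      push_cast
      rw [show (4 : ℤ) * |a| = |4 * a| by rw [abs_mul]; rfl]
      exact (abs_dvd _ _).2 h
    exact this.symm
  rw [jacobiSym.mod_right a hm, jacobiSym.mod_right a hn, h']

lemma J_last (a : ℤ) (ha : a ≠ 0) : jacobiSym a (4 * a.natAbs - 1) = a.sign := by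
  obtain ⟨n, hn⟩ : ∃ n : ℕ, n = a.natAbs := ⟨_, rfl⟩
  have hn0 : 0 < n := by omega
  have hodd : Odd (4 * n - 1) := ⟨2 * n - 1, by omega⟩
  have hpos : jacobiSym (n : ℤ) (4 * n - 1) = 1 := by
    rw [← J_four _ hodd, ← jacobiSym.one_left (4 * n - 1)]
    apply jacobiSym.mod_left'
    apply Int.ModEq.symm
    rw [Int.modEq_iff_dvd]
    refine ⟨1, by push_cast [show 1 ≤ 4 * n by omega]; ring⟩
  rw [← hn]
  rcases lt_or_gt_of_ne ha with h | h
  · have : a = -(n : ℤ) := by omega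
    rw [Int.sign_eq_neg_one_of_neg h, this, jacobiSym.neg _ hodd, hpos,
      ZMod.χ₄_nat_three_mod_four (by omega)]
    norm_num
  · have : a = (n : ℤ) := by omega
    rw [Int.sign_eq_one_of_pos h, this, hpos]

lemma J_reflect (a : ℤ) (ha : a ≠ 0) {m n : ℕ} (hm : Odd m) (hn : Odd n)
    (hg : a.gcd m = 1) (h : 4 * a ∣ (m : ℤ) + n) :
    jacobiSym a n = a.sign * jacobiSym a m := by
  have hl : Odd (4 * a.natAbs - 1) := ⟨2 * a.natAbs - 1, by omega⟩
  have : NeZero m := ⟨by rintro rfl; simp at hm⟩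
  have : NeZero (4 * a.natAbs - 1) := ⟨by omega⟩
  have e : jacobiSym a n = jacobiSym a ((4 * a.natAbs - 1) * m) := by
    apply J_period a hn (hl.mul hm)
    push_cast [show 1 ≤ 4 * a.natAbs by omega]
    have h1 : 4 * a ∣ 4 * |a| * m :=
      Dvd.dvd.mul_right (mul_dvd_mul_left 4 ((dvd_abs _ _).2 dvd_rfl)) _
    have := dvd_sub h h1
    have e : (n : ℤ) - ((4 * |a| - 1) * m) = (m + n) - 4 * |a| * m := by ring
    rw [e]
    exact this
  rw [e, jacobiSym.mul_right, J_last a ha]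

lemma ext_T (c d : ℤ) (hc : 4 ∣ c) (hcop : IsCoprime c d) :
    extJacobi c (d + c) = extJacobi c d := by
  by_cases hc0 : c = 0
  · subst hc0; simp
  obtain ⟨a, rfl⟩ := hc
  have ha : a ≠ 0 := by rintro rfl; simp at hc0
  have hd : d % 2 = 1 := by
    obtain ⟨u, v, huv⟩ := hcop
    rcases Int.emod_two_eq_zero_or_one d with h | h
    · exfalso
      have h2 : (2 : ℤ) ∣ 1 := by
        rw [← huv]
        exact dvd_add (Dvd.dvd.mul_left (Dvd.dvd.mul_right (by norm_num) _) _)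
          (Dvd.dvd.mul_left (Int.dvd_of_emod_eq_zero h) _)
      omega
    · exact h
  have hcop' : IsCoprime a d := hcop.of_mul_left_right
  have hsig : (4 * a).sign = a.sign := by
    rw [Int.sign_mul, show Int.sign 4 = 1 from rfl, one_mul]
  have o1 : Odd d.natAbs := by rw [Nat.odd_iff]; omega
  have o2 : Odd (d + 4 * a).natAbs := by rw [Nat.odd_iff]; omega
  have hg : a.gcd d.natAbs = 1 := by
    have := Int.isCoprime_iff_gcd_eq_one.1 hcop'
    simpa [Int.gcd, Int.natAbs_abs] using this
  have hss : a.sign * a.sign = 1 := by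
    rcases lt_or_gt_of_ne ha with h | h
    · rw [Int.sign_eq_neg_one_of_neg h]; rfl
    · rw [Int.sign_eq_one_of_pos h]; rfl
  unfold extJacobi
  rw [hsig, if_neg hc0, if_neg hc0]
  have n1 : 0 < d → d.toNat = d.natAbs := by omega
  have n2 : ¬ 0 < d → (-d).toNat = d.natAbs := by omega
  have n3 : 0 < d + 4 * a → (d + 4 * a).toNat = (d + 4 * a).natAbs := by omega
  have n4 : ¬ 0 < d + 4 * a → (-(d + 4 * a)).toNat = (d + 4 * a).natAbs := by omega
  split_ifs with h1 h2 h2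
  · rw [n1 h2, n3 h1, J_four _ o1, J_four _ o2]
    exact J_period a o2 o1 ⟨1, by omega⟩
  · rw [n2 h2, n3 h1, J_four _ o1, J_four _ o2]
    exact J_reflect a ha o1 o2 hg ⟨1, by omega⟩
  · rw [n1 h2, n4 h1, J_four _ o1, J_four _ o2, J_reflect a ha o1 o2 hg ⟨-1, by omega⟩,
      ← mul_assoc, hss, one_mul]
  · rw [n2 h2, n4 h1, J_four _ o1, J_four _ o2]
    congr 1
    exact J_period a o2 o1 ⟨-1, by omega⟩

lemma ext_V (c d : ℤ) (hc : 4 ∣ c) (hcop : IsCoprime c d) :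
    extJacobi (c + 4 * d) d =
      if 0 ≤ c ∧ c + 4 * d < 0 then - extJacobi c d else extJacobi c d := by
  rcases lt_trichotomy d 0 with hd | hd | hd
  · have key : jacobiSym (c + 4 * d) (-d).toNat = jacobiSym c (-d).toNat := by
      apply jacobiSym.mod_left'
      apply Int.ModEq.symm
      rw [Int.modEq_iff_dvd]
      exact ⟨-4, by rw [Int.toNat_of_nonneg (by omega)]; ring⟩
    by_cases hc0 : c = 0
    · subst hc0
      have : d = -1 := by
        have := Int.isUnit_iff.1 (isCoprime_zero_left.1 hcop)
        omega
      subst this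
      simp [extJacobi]
    by_cases hc1 : c + 4 * d = 0
    · have hc' : c = -4 * d := by omega
      subst hc'
      have : d = -1 := by
        have := Int.isUnit_iff.1 (isCoprime_self.1 (hcop.of_mul_left_right))
        omega
      subst this
      simp [extJacobi]
      rfl
    unfold extJacobi
    have hd0 : ¬ 0 < d := by omega
    simp only [if_neg hd0, if_neg hc1, if_neg hc0, key]
    split_ifs with h
    · rw [Int.sign_eq_neg_one_of_neg h.2, Int.sign_eq_one_of_pos (by omega)]; ring
    · by_cases h0 : 0 < c
      · rw [Int.sign_eq_one_of_pos h0, Int.sign_eq_one_of_pos (by omega)]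
      · rw [Int.sign_eq_neg_one_of_neg (by omega : c < 0),
          Int.sign_eq_neg_one_of_neg (by omega : c + 4 * d < 0)]
  · subst hd
    have := Int.isUnit_iff.1 (isCoprime_zero_right.1 hcop)
    omega
  · have key : jacobiSym (c + 4 * d) d.toNat = jacobiSym c d.toNat := by
      apply jacobiSym.mod_left'
      apply Int.ModEq.symm
      rw [Int.modEq_iff_dvd]
      exact ⟨4, by rw [Int.toNat_of_nonneg (by omega)]; ring⟩
    rw [if_neg (by omega)]
    unfold extJacobi
    rw [if_pos hd, if_pos hd, key]

/-- The right hand side. -/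
noncomputable def rhsF (c d : ℤ) (z : ℂ) : ℂ :=
  (epsFactor d)⁻¹ * (extJacobi c d : ℂ) * ((c : ℂ) * z + (d : ℂ)) ^ (1 / 2 : ℂ) * jacobiThetaE z

lemma rhsF_T (c d : ℤ) (hc : 4 ∣ c) (hcop : IsCoprime c d) (z : ℂ) :
    rhsF c (d + c) z = rhsF c d (z + 1) := by
  unfold rhsF
  have e : epsFactor (d + c) = epsFactor d := by
    unfold epsFactor
    rw [show (d + c) % 4 = d % 4 by omega]
  rw [ext_T c d hc hcop, thetaE_add_one, e]
  congr 3
  push_cast; ring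

lemma lin_ne (c d : ℤ) (hcop : IsCoprime c d) {z : ℂ} (hz : 0 < z.im) :
    (c : ℂ) * z + d ≠ 0 := by
  intro h
  have h1 := congrArg Complex.im h
  simp at h1
  have hc : c = 0 := by
    rcases h1 with h1 | h1
    · exact h1
    · exact absurd h1 hz.ne'
  subst hc
  simp at h
  subst h
  exact not_isCoprime_zero_zero hcop

lemma rhsF_V (c d : ℤ) (hc : 4 ∣ c) (hcop : IsCoprime c d) {z : ℂ} (hz : 0 < z.im) :
    rhsF (c + 4 * d) d z = rhsF c d (z / (4 * z + 1)) := by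
  unfold rhsF
  rw [ext_V c d hc hcop, thetaE_V hz]
  have h4 := four_ne hz
  have hV := im_V hz
  have h1 := lin_ne c d hcop hV
  have hprod : ((c + 4 * d : ℤ) : ℂ) * z + d = (c * (z / (4 * z + 1)) + d) * (4 * z + 1) := by
    push_cast; field_simp; ring
  have himp : ((((c + 4 * d : ℤ) : ℂ) * z + d)).im = ((c + 4 * d : ℤ) : ℝ) * z.im := by
    rw [add_im, ← ofReal_intCast, im_ofReal_mul]; simp
  have him1 : (((c : ℂ) * (z / (4 * z + 1)) + d)).im = (c : ℝ) * (z / (4 * z + 1)).im := by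
    rw [add_im, ← ofReal_intCast, im_ofReal_mul]; simp
  have hi2 : 0 < (4 * z + 1).im := by simp [hz]
  rw [hprod] at himp ⊢
  set w₁ := (c : ℂ) * (z / (4 * z + 1)) + d
  set w₂ := 4 * z + 1
  have ha2 := arg_nonneg_iff.2 hi2.le
  have ha2' : arg w₂ < π := arg_lt_pi_iff.2 (Or.inr hi2.ne')
  have ha1' := arg_le_pi w₁
  have hn1 : 0 < ‖w₁‖ := norm_pos_iff.2 h1
  have hn2 : 0 < ‖w₂‖ := norm_pos_iff.2 h4
  have hnn := mul_pos hn1 hn2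
  have hpol := mul_im_polar w₁ w₂
  by_cases hcneg : c < 0
  · have : arg w₁ < 0 := by
      rw [arg_neg_iff, him1]
      have : (c : ℝ) < 0 := by exact_mod_cast hcneg
      nlinarith
    rw [if_neg (by omega), cpow_mul_good h1 h4 (by linarith [neg_pi_lt_arg w₁]) (by linarith)]
    ring
  have ha1 : 0 ≤ arg w₁ := by
    rw [arg_nonneg_iff, him1]
    have : (0 : ℝ) ≤ c := by exact_mod_cast (not_lt.1 hcneg)
    positivity
  by_cases hs : arg w₁ + arg w₂ ≤ π
  · have hsin := Real.sin_nonneg_of_nonneg_of_le_pi (by linarith) hs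
    have h0 : 0 ≤ ((c + 4 * d : ℤ) : ℝ) * z.im := by
      rw [← himp, hpol]; positivity
    have h0' : 0 ≤ c + 4 * d := by
      have := nonneg_of_mul_nonneg_left h0 hz
      exact_mod_cast this
    rw [if_neg (by omega), cpow_mul_good h1 h4 (by linarith [Real.pi_pos]) hs]
    ring
  · push Not at hs
    have hsin : Real.sin (arg w₁ + arg w₂) < 0 := by
      have := Real.sin_pos_of_pos_of_lt_pi (x := arg w₁ + arg w₂ - π) (by linarith) (by linarith)
      rw [Real.sin_sub_pi] at this
      linarith
    have h0 : ((c + 4 * d : ℤ) : ℝ) * z.im < 0 := by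
      rw [← himp, hpol]; nlinarith
    have h0' : c + 4 * d < 0 := by
      have := neg_of_mul_neg_left h0 hz.le
      exact_mod_cast this
    rw [if_pos (by omega), cpow_mul_bad h1 h4 hs]
    push_cast
    ring

lemma coprime_of_det {a b c d : ℤ} (h : a * d - b * c = 1) : IsCoprime c d :=
  ⟨-b, a, by linarith⟩

lemma P_T (a b c d : ℤ) (h : a * d - b * c = 1) (hc : 4 ∣ c) :
    (∀ z : ℂ, 0 < z.im → jacobiThetaE ((a * z + b) / (c * z + d)) = rhsF c d z) ↔
    (∀ z : ℂ, 0 < z.im →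
      jacobiThetaE ((a * z + (b + a : ℤ)) / (c * z + (d + c : ℤ))) = rhsF c (d + c) z) := by
  have key : ∀ z : ℂ, (a * z + (b + a : ℤ)) / (c * z + (d + c : ℤ)) =
      (a * (z + 1) + b) / (c * (z + 1) + d) := fun z => by push_cast; ring_nf
  constructor
  · intro H z hz
    rw [key, rhsF_T c d hc (coprime_of_det h)]
    exact H _ (by simpa using hz)
  · intro H z hz
    have := H (z - 1) (by simpa using hz)
    rwa [key, rhsF_T c d hc (coprime_of_det h), sub_add_cancel] at this

lemma P_V (a b c d : ℤ) (h : a * d - b * c = 1) (hc : 4 ∣ c) :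
    (∀ z : ℂ, 0 < z.im → jacobiThetaE ((a * z + b) / (c * z + d)) = rhsF c d z) ↔
    (∀ z : ℂ, 0 < z.im →
      jacobiThetaE (((a + 4 * b : ℤ) * z + b) / ((c + 4 * d : ℤ) * z + d)) =
        rhsF (c + 4 * d) d z) := by
  have key : ∀ z : ℂ, 0 < z.im → ((a + 4 * b : ℤ) * z + b) / ((c + 4 * d : ℤ) * z + d) =
      (a * (z / (4 * z + 1)) + b) / (c * (z / (4 * z + 1)) + d) := fun z hz => by
    have h4 := four_ne hz
    rw [← mul_div_mul_right _ (c * (z / (4 * z + 1)) + d : ℂ) h4]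
    push_cast
    congr 1 <;> (field_simp; ring)
  constructor
  · intro H z hz
    rw [key z hz, rhsF_V c d hc (coprime_of_det h) hz]
    exact H _ (im_V hz)
  · intro H z hz
    have hm : 1 - 4 * z ≠ 0 := by
      intro hh
      have := congrArg Complex.im hh
      simp at this
      exact hz.ne' this
    have hw : 0 < (z / (1 - 4 * z)).im := by
      have hp := normSq_pos.2 hm
      have : (z / (1 - 4 * z)).im = z.im / normSq (1 - 4 * z) := by
        rw [div_im]; simp; field_simp; ring
      rw [this]; positivity
    have h4 := four_ne hw
    have e : z / (1 - 4 * z) / (4 * (z / (1 - 4 * z)) + 1) = z := by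
      have : 4 * (z / (1 - 4 * z)) + 1 = 1 / (1 - 4 * z) := by field_simp; ring
      rw [this, div_div_div_cancel_right₀ hm, div_one]
    have := H _ hw
    rwa [key _ hw, rhsF_V c d hc (coprime_of_det h) hw, e] at this

lemma thetaE_add_int (z : ℂ) (n : ℤ) : jacobiThetaE (z + n) = jacobiThetaE z := by
  induction n using Int.induction_on with
  | zero => simp
  | succ i ih => push_cast at *; rw [← add_assoc, thetaE_add_one, ih]
  | pred i ih =>
    rw [← thetaE_add_one]; push_cast at *
    rw [← ih]; congr 1; ring

lemma P_all (N : ℕ) : ∀ (a b c d : ℤ), c.natAbs + d.natAbs ≤ N → a * d - b * c = 1 → 4 ∣ c →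
    ∀ z : ℂ, 0 < z.im → jacobiThetaE ((a * z + b) / (c * z + d)) = rhsF c d z := by
  induction N with
  | zero =>
    intro a b c d hN h
    have hc : c = 0 := by omega
    have hd : d = 0 := by omega
    subst hc hd
    simp at h
  | succ N ih =>
    intro a b c d hN h hc
    have hcop := coprime_of_det h
    by_cases hc0 : c = 0
    · subst hc0
      intro z hz
      have hd := Int.isUnit_iff.1 (isCoprime_zero_left.1 hcop)
      rcases hd with rfl | rfl
      · have : a = 1 := by omega
        subst this
        simp [rhsF, epsFactor, extJacobi, thetaE_add_int]
      · have : a = -1 := by omega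
        subst this
        have e : (((-1 : ℤ) : ℂ) * z + b) / (((0 : ℤ) : ℂ) * z + ((-1 : ℤ) : ℂ)) =
          z + ((-b : ℤ) : ℂ) := by push_cast; ring
        have e2 : (-1 : ℂ) ^ (2⁻¹ : ℂ) = I := by
          rw [cpow_def_of_ne_zero (by norm_num), log_neg_one,
            show (π : ℂ) * I * 2⁻¹ = π / 2 * I by ring, exp_pi_div_two_mul_I]
        rw [e, thetaE_add_int]
        simp [rhsF, epsFactor, extJacobi, e2]
    have hd2 : d % 2 = 1 := by
      rcases Int.emod_two_eq_zero_or_one d with h0 | h0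
      · exfalso
        have h2 : (2 : ℤ) ∣ 1 := by
          rw [← h]
          exact dvd_sub (Dvd.dvd.mul_left (Int.dvd_of_emod_eq_zero h0) _)
            (Dvd.dvd.mul_left (dvd_trans (by norm_num) hc) _)
        omega
      · exact h0
    by_cases hlt : c.natAbs < 2 * d.natAbs
    · -- reduce `d`
      by_cases hs : (0 < c ∧ 0 < d) ∨ (c < 0 ∧ d < 0)
      · have h' : a * (d - c) - (b - a) * c = 1 := by linarith
        have := (P_T a (b - a) c (d - c) h' hc).1 (ih a (b - a) c (d - c) (by omega) h' hc)
        simpa only [sub_add_cancel] using this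
      · have h' : a * (d + c) - (b + a) * c = 1 := by linarith
        exact (P_T a b c d h hc).2 (ih a (b + a) c (d + c) (by omega) h' hc)
    · by_cases hs : (0 < c ∧ 0 < d) ∨ (c < 0 ∧ d < 0)
      · have h' : (a - 4 * b) * d - b * (c - 4 * d) = 1 := by linarith
        have hc' : 4 ∣ c - 4 * d := by omega
        have := (P_V (a - 4 * b) b (c - 4 * d) d h' hc').1
          (ih (a - 4 * b) b (c - 4 * d) d (by omega) h' hc')
        simpa only [sub_add_cancel] using this
      · have h' : (a + 4 * b) * d - b * (c + 4 * d) = 1 := by linarith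
        exact (P_V a b c d h hc).2 (ih (a + 4 * b) b (c + 4 * d) d (by omega) h' (by omega))

/-- For every `A = (a b; c d) ∈ SL(2,ℤ)` with `4 ∣ c` and every `z ∈ ℍ`,
`θ((az+b)/(cz+d)) = ε_d⁻¹·(c/d)·(cz+d)^{1/2}·θ(z)` with the principal branch
of the square root. -/
theorem stmt10 (a b c d : ℤ) (hdet : a * d - b * c = 1) (hc : (4 : ℤ) ∣ c)
    (z : ℂ) (hz : 0 < z.im) :
    jacobiThetaE (((a : ℂ) * z + (b : ℂ)) / ((c : ℂ) * z + (d : ℂ))) =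
      (epsFactor d)⁻¹ * (extJacobi c d : ℂ) * ((c : ℂ) * z + (d : ℂ)) ^ (1 / 2 : ℂ) *
        jacobiThetaE z := by
  exact P_all _ a b c d le_rfl hdet hc z hz
end

section
/- A positive integer n is a perfect square if and only if the Jacobi symbol (n/d) equals 1 for every positive odd integer d that is coprime to 4n. -/
theorem stmt12_key (q m e : ℕ) (hq : q.Prime) (hm : 0 < m) (hqm : ¬ q ∣ m) (he : Odd e) :
    ∃ d : ℕ, 0 < d ∧ Odd d ∧ Nat.Coprime d (4 * (q ^ e * m)) ∧
      jacobiSym ((q ^ e * m : ℕ) : ℤ) d = -1 := by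
  have hcop : Nat.Coprime q m := (Nat.Prime.coprime_iff_not_dvd hq).2 hqm
  -- it suffices to make the two factors have symbols -1 and 1
  suffices h : ∃ d : ℕ, d % 4 = 1 ∧ Nat.Coprime d q ∧ Nat.Coprime d m ∧
      jacobiSym q d = -1 ∧ jacobiSym m d = 1 by
    obtain ⟨d, h4, h1, h2, h3, h5⟩ := h
    have hodd : Odd d := Nat.odd_iff.2 (by omega)
    refine ⟨d, by omega, hodd, ?_, ?_⟩
    · have : Nat.Coprime d 2 := hodd.coprime_two_right
      have h44 : Nat.Coprime d 4 := by
        have := this.pow_right 2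
        simpa using this
      exact h44.mul_right ((h1.pow_right e).mul_right h2)
    · push_cast
      rw [jacobiSym.mul_left, jacobiSym.pow_left, h3, h5, he.neg_one_pow, mul_one]
  rcases hq.eq_two_or_odd' with rfl | hqo
  · have hmo : Odd m := by
      rw [← Nat.not_even_iff_odd, even_iff_two_dvd]; exact hqm
    have h8 : Nat.Coprime 8 m := by
      have := hcop.pow_left 3
      simpa using this
    obtain ⟨d, hd8, hdm⟩ := Nat.chineseRemainder h8 5 1
    have hd8' : d % 8 = 5 := hd8
    have hdo : Odd d := Nat.odd_iff.2 (by omega)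
    refine ⟨d, by omega, hdo.coprime_two_right, ?_, ?_, ?_⟩
    · have := Nat.ModEq.gcd_eq hdm
      simpa [Nat.Coprime] using this
    · have := jacobiSym.at_two hdo
      rw [ZMod.χ₈_nat_mod_eight, hd8'] at this
      rw [Nat.cast_ofNat, this]; decide
    · rw [jacobiSym.quadratic_reciprocity_one_mod_four' hmo (by omega)]
      have : ((d : ℤ)) % m = 1 % m := by exact_mod_cast hdm
      rw [jacobiSym.mod_left' this, jacobiSym.one_left]
  · have : Fact q.Prime := ⟨hq⟩
    obtain ⟨u, hu⟩ : ∃ u : ZMod q, ¬ IsSquare u := by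
      apply FiniteField.exists_nonsquare
      rw [ZMod.ringChar_zmod_n]
      rintro rfl
      exact absurd hqo (by decide)
    have h8 : Nat.Coprime (8 * m) q := by
      have h2 : Nat.Coprime 2 q := hqo.coprime_two_left
      have := h2.pow_left 3
      exact Nat.Coprime.mul_left (by simpa using this) hcop.symm
    obtain ⟨d, hdm, hdq⟩ := Nat.chineseRemainder h8 1 u.val
    have hd8 : d % 8 = 1 := hdm.of_mul_right m
    have hdm1 : d ≡ 1 [MOD m] := hdm.of_mul_left 8
    have hdm4 : d ≡ 1 [MOD 4 * m] := by
      apply Nat.ModEq.of_mul_left 2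
      rwa [← mul_assoc]
    have hdo : Odd d := Nat.odd_iff.2 (by omega)
    have hdu : ((d : ℤ) : ZMod q) = u := by
      have := (ZMod.natCast_eq_natCast_iff _ _ _).2 hdq
      rw [ZMod.natCast_zmod_val] at this
      exact_mod_cast this
    have hJ : jacobiSym (d : ℤ) q = -1 := by
      rw [ZMod.nonsquare_iff_jacobiSym_eq_neg_one, hdu]; exact hu
    refine ⟨d, by omega, ?_, ?_, ?_, ?_⟩
    · rw [Nat.coprime_comm, Nat.Prime.coprime_iff_not_dvd hq]
      intro hdvd
      apply hu
      rw [← hdu, Int.cast_natCast, (ZMod.natCast_eq_zero_iff _ _).2 hdvd]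
      exact IsSquare.zero
    · have := Nat.ModEq.gcd_eq hdm1
      simpa [Nat.Coprime] using this
    · rw [jacobiSym.quadratic_reciprocity_one_mod_four' hqo (by omega), hJ]
    · rw [jacobiSym.mod_right' m hdo, hdm4, Nat.mod_eq_of_lt (by omega), jacobiSym.one_right]

/-- A positive integer `n` is a perfect square iff the Jacobi symbol `(n/d)`
equals `1` for every positive odd integer `d` coprime to `4n`. -/
theorem stmt12 (n : ℕ) (hn : 0 < n) :
    (∃ m : ℕ, n = m ^ 2) ↔
      ∀ d : ℕ, 0 < d → Odd d → Nat.Coprime d (4 * n) → jacobiSym (n : ℤ) d = 1 := by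
  constructor
  · rintro ⟨m, rfl⟩ d hd ho hc
    push_cast
    apply jacobiSym.sq_one'
    have h1 : Nat.Coprime d (m ^ 2) := Nat.Coprime.coprime_mul_left_right hc
    have h2 : Nat.Coprime d m := (Nat.coprime_pow_right_iff (by norm_num) _ _).1 h1
    simpa [Int.gcd_natCast_natCast] using h2.symm
  · intro h
    obtain ⟨a, b, hab, hsq⟩ := Nat.sq_mul_squarefree n
    by_cases ha : a = 1
    · exact ⟨b, by rw [← hab, ha, mul_one]⟩
    exfalso
    obtain ⟨q, hq, hqa⟩ := Nat.exists_prime_and_dvd ha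
    have ha0 : a ≠ 0 := hsq.ne_zero
    have hb0 : b ≠ 0 := by rintro rfl; simp at hab; omega
    have he : Odd (n.factorization q) := by
      have h1 : a.factorization q = 1 := by
        have := hsq.natFactorization_le_one q
        have := hq.factorization_pos_of_dvd ha0 hqa
        omega
      rw [← hab, Nat.factorization_mul (pow_ne_zero 2 hb0) ha0, Nat.factorization_pow]
      simp [h1]
    obtain ⟨d, hd, ho, hc, hJ⟩ := stmt12_key q (n / q ^ n.factorization q) (n.factorization q) hq
      (Nat.ordCompl_pos q hn.ne') (Nat.not_dvd_ordCompl hq hn.ne') he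
    rw [Nat.ordProj_mul_ordCompl_eq_self] at hc hJ
    have := h d hd ho hc
    omega
end

section
/- Let k ∈ ℝ and A ∈ SL(2,ℝ). For every twice continuously differentiable function f : ℍ → ℂ, the weight-k Laplacian commutes with the weight-k slash action: Δ_k(f|[k,A]) = (Δ_k f)|[k,A]. -/
open Complex Real

/-- The weight-`k` slash operator `f|[k,A](z) = e^{−ik Arg(cz+d)}·f(Az)`. -/
noncomputable def slash (k : ℝ) (A : Matrix (Fin 2) (Fin 2) ℝ) (f : ℂ → ℂ) : ℂ → ℂ :=
  fun z =>
    Complex.exp (-Complex.I * (k : ℂ) * (((A 1 0 : ℝ) : ℂ) * z + ((A 1 1 : ℝ) : ℂ)).arg) *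
      f ((((A 0 0 : ℝ) : ℂ) * z + ((A 0 1 : ℝ) : ℂ)) /
          (((A 1 0 : ℝ) : ℂ) * z + ((A 1 1 : ℝ) : ℂ)))

/-- Partial derivative `∂f/∂x` (real-direction Fréchet derivative). -/
noncomputable def pdX (f : ℂ → ℂ) (z : ℂ) : ℂ := fderiv ℝ f z 1

/-- Partial derivative `∂f/∂y` (imaginary-direction Fréchet derivative). -/
noncomputable def pdY (f : ℂ → ℂ) (z : ℂ) : ℂ := fderiv ℝ f z Complex.I

/-- The weight-`k` Laplacian `Δ_k = y²(∂²/∂x² + ∂²/∂y²) − i k y ∂/∂x`. -/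
noncomputable def weightLap (k : ℝ) (f : ℂ → ℂ) (z : ℂ) : ℂ :=
  (z.im : ℂ) ^ 2 * (pdX (pdX f) z + pdY (pdY f) z) - Complex.I * (k : ℂ) * (z.im : ℂ) * pdX f z

lemma aux_j_ne {c d : ℝ} (h : c ≠ 0 ∨ d ≠ 0) {z : ℂ} (hz : 0 < z.im) :
    (c : ℂ) * z + (d : ℂ) ≠ 0 := by
  intro h0
  have h1 := congrArg Complex.im h0
  have h2 := congrArg Complex.re h0
  simp at h1 h2
  rcases h1 with h1 | h1
  · subst h1
    simp at h2
    simp [h2] at h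
  · exact hz.ne' h1

lemma aux_J (k : ℝ) {c d : ℝ} (h : c ≠ 0 ∨ d ≠ 0) {z : ℂ} (hz : 0 < z.im) :
    ∃ L : ℂ →L[ℝ] ℂ, HasFDerivAt
      (fun z : ℂ => Complex.exp (-Complex.I * (k : ℂ) * ((c : ℂ) * z + (d : ℂ)).arg)) L z ∧
      ∀ v, L v = Complex.exp (-Complex.I * (k : ℂ) * ((c : ℂ) * z + (d : ℂ)).arg) *
        (-Complex.I * k * ((c * v * ((c : ℂ) * z + (d : ℂ))⁻¹).im : ℝ)) := by
  by_cases hc : c = 0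
  · subst hc
    refine ⟨0, ?_, ?_⟩
    · simpa using hasFDerivAt_const (𝕜 := ℝ)
        (Complex.exp (-(Complex.I * (k : ℂ) * ((d : ℂ)).arg))) z
    · simp
  · have hs : (c : ℂ) * z + (d : ℂ) ∈ Complex.slitPlane := by
      right
      simp [hc, hz.ne']
    have h1 : HasDerivAt (fun z : ℂ => (c : ℂ) * z + (d : ℂ)) (c : ℂ) z := by
      simpa using ((hasDerivAt_id z).const_mul (c : ℂ)).add_const (d : ℂ)
    have h2 := (h1.clog hs).hasFDerivAt.restrictScalars ℝ
    have h3 := (Complex.ofRealCLM.comp Complex.imCLM).hasFDerivAt.comp z h2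
    have h4 := (h3.const_mul (-Complex.I * (k : ℂ))).cexp
    refine ⟨_, h4.congr_of_eventuallyEq (Filter.Eventually.of_forall fun w => ?_), ?_⟩
    · simp [Complex.log_im]
    · intro v
      simp [Complex.log_im, div_eq_mul_inv]
      left
      ring

lemma aux_u {c d : ℝ} (h : c ≠ 0 ∨ d ≠ 0) {z : ℂ} (hz : 0 < z.im) :
    HasDerivAt (fun z : ℂ => ((c : ℂ) * z + (d : ℂ))⁻¹) (-c * (((c : ℂ) * z + (d : ℂ))⁻¹) ^ 2) z := by
  have h1 : HasDerivAt (fun z : ℂ => (c : ℂ) * z + (d : ℂ)) (c : ℂ) z := by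
    simpa using ((hasDerivAt_id z).const_mul (c : ℂ)).add_const (d : ℂ)
  refine (h1.inv (aux_j_ne h hz)).congr_deriv ?_
  simp [div_eq_mul_inv]

lemma aux_M {a b c d : ℝ} (h : a * d - b * c = 1) {z : ℂ} (hz : 0 < z.im) :
    HasDerivAt (fun z : ℂ => ((a : ℂ) * z + b) / ((c : ℂ) * z + (d : ℂ)))
      ((((c : ℂ) * z + (d : ℂ))⁻¹) ^ 2) z := by
  have hcd : c ≠ 0 ∨ d ≠ 0 := by
    by_contra! hh
    simp [hh.1, hh.2] at h
  have h1 : HasDerivAt (fun z : ℂ => (c : ℂ) * z + (d : ℂ)) (c : ℂ) z := by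
    simpa using ((hasDerivAt_id z).const_mul (c : ℂ)).add_const (d : ℂ)
  have h2 : HasDerivAt (fun z : ℂ => (a : ℂ) * z + (b : ℂ)) (a : ℂ) z := by
    simpa using ((hasDerivAt_id z).const_mul (a : ℂ)).add_const (b : ℂ)
  have hj := aux_j_ne hcd hz
  refine (h2.div h1 hj).congr_deriv ?_
  have h' : (a : ℂ) * d - b * c = 1 := by exact_mod_cast h
  field_simp
  linear_combination h'

lemma aux_im {a b c d : ℝ} (h : a * d - b * c = 1) (z : ℂ) :
    (((a : ℂ) * z + b) / ((c : ℂ) * z + (d : ℂ))).im =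
      z.im * Complex.normSq (((c : ℂ) * z + (d : ℂ))⁻¹) := by
  rw [Complex.normSq_inv, Complex.div_im]
  simp
  rw [← sub_div, ← div_eq_mul_inv]
  congr 1
  linear_combination z.im * h

lemma aux_first (k : ℝ) {a b c d : ℝ} (h : a * d - b * c = 1) {f : ℂ → ℂ}
    (hf : ContDiffOn ℝ 2 f {z : ℂ | 0 < z.im}) {z : ℂ} (hz : 0 < z.im)
    (hM : 0 < (((a : ℂ) * z + b) / ((c : ℂ) * z + (d : ℂ))).im) (v : ℂ) :
    fderiv ℝ (fun z : ℂ => Complex.exp (-Complex.I * (k : ℂ) * ((c : ℂ) * z + (d : ℂ)).arg) *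
      f (((a : ℂ) * z + b) / ((c : ℂ) * z + (d : ℂ)))) z v =
    Complex.exp (-Complex.I * (k : ℂ) * ((c : ℂ) * z + (d : ℂ)).arg) *
      (-Complex.I * k * ((c * v * ((c : ℂ) * z + (d : ℂ))⁻¹).im : ℝ) *
        f (((a : ℂ) * z + b) / ((c : ℂ) * z + (d : ℂ))) +
       fderiv ℝ f (((a : ℂ) * z + b) / ((c : ℂ) * z + (d : ℂ)))
        (v * (((c : ℂ) * z + (d : ℂ))⁻¹) ^ 2)) := by
  have hcd : c ≠ 0 ∨ d ≠ 0 := by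
    by_contra! hh
    simp [hh.1, hh.2] at h
  have ho : IsOpen {z : ℂ | 0 < z.im} := isOpen_lt continuous_const Complex.continuous_im
  obtain ⟨L, hL, hLv⟩ := aux_J k hcd hz
  have hfd : HasFDerivAt f _ (((a : ℂ) * z + b) / ((c : ℂ) * z + (d : ℂ))) :=
    ((hf.contDiffAt (ho.mem_nhds hM)).differentiableAt (by norm_num)).hasFDerivAt
  have h2 := hfd.comp z ((aux_M h hz).hasFDerivAt.restrictScalars ℝ)
  have h3 := hL.mul h2
  erw [h3.fderiv]
  simp [hLv]
  ring

lemma aux_second (k : ℝ) {a b c d : ℝ} (h : a * d - b * c = 1) {f : ℂ → ℂ}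
    (hf : ContDiffOn ℝ 2 f {z : ℂ | 0 < z.im}) {z : ℂ} (hz : 0 < z.im) (v : ℂ) :
    fderiv ℝ (fun z => fderiv ℝ (fun z : ℂ =>
      Complex.exp (-Complex.I * (k : ℂ) * ((c : ℂ) * z + (d : ℂ)).arg) *
      f (((a : ℂ) * z + b) / ((c : ℂ) * z + (d : ℂ)))) z v) z v =
    Complex.exp (-Complex.I * (k : ℂ) * ((c : ℂ) * z + (d : ℂ)).arg) *
      ((-Complex.I * k * ((c * v * ((c : ℂ) * z + (d : ℂ))⁻¹).im : ℝ)) ^ 2 *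
        f (((a : ℂ) * z + b) / ((c : ℂ) * z + (d : ℂ))) +
       2 * (-Complex.I * k * ((c * v * ((c : ℂ) * z + (d : ℂ))⁻¹).im : ℝ)) *
       fderiv ℝ f (((a : ℂ) * z + b) / ((c : ℂ) * z + (d : ℂ)))
        (v * (((c : ℂ) * z + (d : ℂ))⁻¹) ^ 2) +
       -Complex.I * k * ((c * v * (v * (-c * (((c : ℂ) * z + (d : ℂ))⁻¹) ^ 2))).im : ℝ) *
        f (((a : ℂ) * z + b) / ((c : ℂ) * z + (d : ℂ))) +
       fderiv ℝ (fderiv ℝ f) (((a : ℂ) * z + b) / ((c : ℂ) * z + (d : ℂ)))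
        (v * (((c : ℂ) * z + (d : ℂ))⁻¹) ^ 2) (v * (((c : ℂ) * z + (d : ℂ))⁻¹) ^ 2) +
       fderiv ℝ f (((a : ℂ) * z + b) / ((c : ℂ) * z + (d : ℂ)))
        (v * (v * (2 * (((c : ℂ) * z + (d : ℂ))⁻¹) *
          (-c * (((c : ℂ) * z + (d : ℂ))⁻¹) ^ 2))))) := by
  have hcd : c ≠ 0 ∨ d ≠ 0 := by
    by_contra! hh
    simp [hh.1, hh.2] at h
  have hMM : ∀ z : ℂ, 0 < z.im → 0 < (((a : ℂ) * z + b) / ((c : ℂ) * z + (d : ℂ))).im := by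
    intro z hz
    rw [aux_im h]
    exact mul_pos hz (Complex.normSq_pos.2 (inv_ne_zero (aux_j_ne hcd hz)))
  have hM := hMM z hz
  have ho : IsOpen {z : ℂ | 0 < z.im} := isOpen_lt continuous_const Complex.continuous_im
  have hev := Filter.eventually_of_mem (ho.mem_nhds hz)
    (fun w (hw : 0 < w.im) => aux_first k h hf hw (hMM w hw) v)
  rw [Filter.EventuallyEq.fderiv_eq hev]
  obtain ⟨L, hL, hLv⟩ := aux_J k hcd hz
  have hcda := hf.contDiffAt (ho.mem_nhds hM)
  have hfd : HasFDerivAt f _ (((a : ℂ) * z + b) / ((c : ℂ) * z + (d : ℂ))) :=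
    (hcda.differentiableAt (by norm_num)).hasFDerivAt
  have hfd2 : HasFDerivAt (fderiv ℝ f) _ (((a : ℂ) * z + b) / ((c : ℂ) * z + (d : ℂ))) :=
    ((hcda.fderiv_right (m := 1) (by norm_num)).differentiableAt (by norm_num)).hasFDerivAt
  have hMd := (aux_M h hz).hasFDerivAt.restrictScalars ℝ
  have h2 := hfd.comp z hMd
  have h22 := hfd2.comp z hMd
  have hu1 := ((aux_u hcd hz).const_mul (c * v)).hasFDerivAt.restrictScalars ℝ
  have hu2 := (((aux_u hcd hz).pow 2).const_mul v).hasFDerivAt.restrictScalars ℝ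
  have h3 := ((Complex.ofRealCLM.comp Complex.imCLM).hasFDerivAt.comp z hu1).const_mul
    (-Complex.I * (k : ℂ))
  have h5 := hL.mul ((h3.mul h2).add (h22.clm_apply hu2))
  erw [h5.fderiv]
  simp only [_root_.add_apply, _root_.smul_apply,
    ContinuousLinearMap.comp_apply, hLv, ContinuousLinearMap.coe_restrictScalars',
    Function.comp_apply, smul_eq_mul, ContinuousLinearMap.flip_apply,
    ContinuousLinearMap.toSpanSingleton_apply, Complex.ofRealCLM_apply, Complex.imCLM_apply,
    Pi.mul_apply, Pi.add_apply, Pi.pow_apply]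
  rw [show v * (c * v * (-c * (((c : ℂ) * z + (d : ℂ))⁻¹) ^ 2)) =
    c * v * (v * (-c * (((c : ℂ) * z + (d : ℂ))⁻¹) ^ 2)) by ring,
    show (2 - 1 : ℕ) = 1 from rfl, pow_one, Nat.cast_ofNat]
  ring

lemma aux_lin (L : ℂ →L[ℝ] ℂ) (w : ℂ) : L w = w.re * L 1 + w.im * L Complex.I := by
  have : w = w.re • (1 : ℂ) + w.im • Complex.I := by
    apply Complex.ext <;> simp
  conv_lhs => rw [this, map_add, map_smul, map_smul]
  simp

lemma aux_pd {f : ℂ → ℂ} {w : ℂ} (h : DifferentiableAt ℝ (fderiv ℝ f) w) (v : ℂ) :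
    fderiv ℝ (fun z => fderiv ℝ f z v) w v = fderiv ℝ (fderiv ℝ f) w v v := by
  rw [(h.hasFDerivAt.clm_apply (hasFDerivAt_const v w)).fderiv]
  simp

/-- For `k ∈ ℝ`, `A ∈ SL(2,ℝ)` and a twice continuously differentiable
`f` on ℍ, the weight-`k` Laplacian commutes with the weight-`k` slash action:
`Δ_k(f|[k,A]) = (Δ_k f)|[k,A]`. -/
theorem stmt16 (k : ℝ) (A : Matrix.SpecialLinearGroup (Fin 2) ℝ) (f : ℂ → ℂ)
    (hf : ContDiffOn ℝ 2 f {z : ℂ | 0 < z.im}) :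
    ∀ z : ℂ, 0 < z.im →
      weightLap k (slash k (A : Matrix (Fin 2) (Fin 2) ℝ) f) z =
        slash k (A : Matrix (Fin 2) (Fin 2) ℝ) (fun w => weightLap k f w) z := by
  intro z hz
  have hdet := A.det_coe
  rw [Matrix.det_fin_two] at hdet
  unfold weightLap slash pdX pdY
  dsimp only
  generalize (A : Matrix (Fin 2) (Fin 2) ℝ) 0 0 = a at *
  generalize (A : Matrix (Fin 2) (Fin 2) ℝ) 0 1 = b at *
  generalize (A : Matrix (Fin 2) (Fin 2) ℝ) 1 0 = c at *
  generalize (A : Matrix (Fin 2) (Fin 2) ℝ) 1 1 = d at *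
  have hcd : c ≠ 0 ∨ d ≠ 0 := by
    by_contra! hh
    simp [hh.1, hh.2] at hdet
  have hj := aux_j_ne hcd hz
  have hM : 0 < (((a : ℂ) * z + b) / ((c : ℂ) * z + (d : ℂ))).im := by
    rw [aux_im hdet]
    exact mul_pos hz (Complex.normSq_pos.2 (inv_ne_zero hj))
  have ho : IsOpen {z : ℂ | 0 < z.im} := isOpen_lt continuous_const Complex.continuous_im
  have hcda := hf.contDiffAt (ho.mem_nhds hM)
  have hd2 := (hcda.fderiv_right (m := 1) (by norm_num)).differentiableAt (by norm_num)
  rw [aux_second k hdet hf hz, aux_second k hdet hf hz, aux_first k hdet hf hz hM,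
    aux_pd hd2, aux_pd hd2, aux_im hdet]
  have hrel : c * z.im * Complex.normSq (((c : ℂ) * z + (d : ℂ))⁻¹) =
      -(((c : ℂ) * z + (d : ℂ))⁻¹).im := by
    rw [Complex.normSq_inv, Complex.inv_im]
    simp [div_eq_mul_inv]
  generalize ((c : ℂ) * z + (d : ℂ))⁻¹ = u at *
  generalize ((a : ℂ) * z + b) / ((c : ℂ) * z + (d : ℂ)) = w at *
  generalize Complex.exp (-Complex.I * (k : ℂ) * ((c : ℂ) * z + (d : ℂ)).arg) = J at *
  generalize fderiv ℝ (fderiv ℝ f) w = B at *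
  generalize fderiv ℝ f w = D at *
  have hB : ∀ w, B w w = w.re ^ 2 * B 1 1 + w.re * w.im * (B 1 Complex.I + B Complex.I 1) +
      w.im ^ 2 * B Complex.I Complex.I := by
    intro w
    have h1 := aux_lin (B.flip w) w
    simp only [ContinuousLinearMap.flip_apply] at h1
    rw [h1, aux_lin (B 1) w, aux_lin (B Complex.I) w]
    ring
  rw [hB (1 * u ^ 2), hB (Complex.I * u ^ 2), aux_lin D (1 * u ^ 2), aux_lin D (Complex.I * u ^ 2),
    aux_lin D (1 * _), aux_lin D (Complex.I * (_ * _))]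
  obtain ⟨p, q⟩ := u
  rw [Complex.normSq_mk] at *
  have hrel' : (c : ℂ) * z.im * (p * p + q * q) = - q := by exact_mod_cast hrel
  have hI : Complex.I ^ 2 = -1 := Complex.I_sq
  simp [pow_two]
  linear_combination (Complex.I ^ 2 * k ^ 2 * c * z.im * f w * J +
    2 * Complex.I * k * z.im * J * (q * D 1 - p * D Complex.I)) * hrel'
end
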